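/- arXiv:math/0611356 — 4 statements merged into one kernel-verified Lean document; each statement's English description precedes it below -/
import Mathlib

section
/- For every n there is a constant cₙ depending only on n such that for all m, all A ∈ ℤ^{m×n} of rank n and b ∈ ℤ^m with {x ∈ ℝⁿ : Ax ≤ b} nonempty and bounded, |N(A,b)| ≤ cₙ · m^{⌊n/2⌋} · (log₂(1 + α₁))^{n−1}, where α₁ = max{|a_{ij}| : i = 1,…,m; j = 1,…,n}. In particular the bound does not depend on the right-hand side vector b. -/
/-- The set `M(A,b) = {x ∈ ℤⁿ : Ax ≤ b}`, viewed inside `ℝⁿ`. -/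
def intPoints (m n : ℕ) (A : Matrix (Fin m) (Fin n) ℤ) (b : Fin m → ℤ) :
    Set (Fin n → ℝ) :=
  {x | (∀ j, ∃ z : ℤ, x j = (z : ℝ)) ∧ ∀ i, ∑ j, (A i j : ℝ) * x j ≤ (b i : ℝ)}

/-- `N(A,b)`: the set of vertices (extreme points) of `P_I`, the convex hull of
`M(A,b) = {x ∈ ℤⁿ : Ax ≤ b}`. -/
def vertN (m n : ℕ) (A : Matrix (Fin m) (Fin n) ℤ) (b : Fin m → ℤ) :
    Set (Fin n → ℝ) :=
  Set.extremePoints ℝ (convexHull ℝ (intPoints m n A b))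

lemma generic_eps {m n : ℕ} (a : Fin m → Fin n → ℝ) (b : Fin m → ℝ) :
    ∃ β : Fin m → ℝ, (∀ i, b i < β i ∧ β i < b i + 1/2) ∧
      ∀ v : Fin n → ℝ, LinearIndepOn ℝ a {i | a i ⬝ᵥ v = β i} := by
  classical
  have h : ∀ T : Finset (Fin m), ∃ z : Fin m → ℝ, ¬ LinearIndepOn ℝ a (T : Set (Fin m)) →
      (z ≠ 0 ∧ (∀ i ∉ T, z i = 0) ∧ ∑ i, z i • a i = 0) := by
    intro T
    by_cases hT : LinearIndepOn ℝ a (T : Set (Fin m))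
    · exact ⟨0, fun h => absurd hT h⟩
    · have hT' := hT
      rw [linearIndepOn_finset_iff] at hT'
      push Not at hT'
      obtain ⟨f, hf, i, hi, hfi⟩ := hT'
      refine ⟨fun i => if i ∈ T then f i else 0, fun _ => ⟨?_, ?_, ?_⟩⟩
      · intro h0
        have := congrFun h0 i
        simp [hi, hfi] at this
      · intro i hi; simp [hi]
      · rw [← hf]
        simp [ite_smul, Finset.sum_ite_mem]
  choose z hz using h
  let p : Finset (Fin m) → Polynomial ℝ := fun T =>
    Polynomial.C (∑ i, z T i * b i) + ∑ i : Fin m, Polynomial.C (z T i) * Polynomial.X ^ (i.val + 1)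
  have hp : ∀ T, z T ≠ 0 → p T ≠ 0 := by
    intro T hzT h0
    apply hzT
    funext j
    have := congrArg (fun q => Polynomial.coeff q (j.val + 1)) h0
    simp only [p, Polynomial.coeff_add, Polynomial.coeff_C_succ, Polynomial.finsetSum_coeff,
      Polynomial.coeff_C_mul, Polynomial.coeff_X_pow, Polynomial.coeff_zero] at this
    rw [Finset.sum_eq_single j] at this
    · simpa using this
    · intro k _ hk
      have : ¬ (j.val + 1 = k.val + 1) := fun h => hk (Fin.ext (by omega))
      rw [if_neg this, mul_zero]
    · simp
  have hfin : (⋃ T : Finset (Fin m), {t : ℝ | z T ≠ 0 ∧ (p T).IsRoot t}).Finite := by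
    apply Set.finite_iUnion
    intro T
    by_cases h0 : z T = 0
    · simp [h0]
    · exact (Polynomial.finite_setOfPred_isRoot (hp T h0)).subset (fun t ht => ht.2)
  obtain ⟨t, ht, htn⟩ := ((Set.Ioo_infinite (show (0:ℝ) < 1/2 by norm_num)).sdiff hfin).nonempty
  refine ⟨fun i => b i + t ^ (i.val + 1), ?_, ?_⟩
  · intro i
    have h1 : 0 < t ^ (i.val+1) := pow_pos ht.1 _
    have h2 : t ^ (i.val+1) ≤ t := by
      have := pow_le_pow_of_le_one ht.1.le (by linarith [ht.2]) (show 1 ≤ i.val+1 by omega)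
      simpa using this
    have := ht.2
    constructor <;> linarith
  · intro v
    by_contra hv
    set T : Finset (Fin m) := Finset.univ.filter fun i => a i ⬝ᵥ v = b i + t ^ (i.val + 1) with hT
    have hv' : ¬ LinearIndepOn ℝ a (T : Set (Fin m)) := by
      simpa [hT] using hv
    obtain ⟨h1, h2, h3⟩ := hz T hv'
    apply htn
    refine Set.mem_iUnion.2 ⟨T, h1, ?_⟩
    have h4 : (∑ i, z T i • a i) ⬝ᵥ v = 0 := by rw [h3]; simp
    rw [sum_dotProduct] at h4
    have h5 : ∀ i, (z T i • a i) ⬝ᵥ v = z T i * (b i + t ^ (i.val+1)) := by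
      intro i
      rw [smul_dotProduct, smul_eq_mul]
      by_cases hi : i ∈ T
      · rw [(Finset.mem_filter.1 hi).2]
      · rw [h2 i hi]; simp
    simp only [h5] at h4
    simp only [p, Polynomial.IsRoot, Polynomial.eval_add, Polynomial.eval_C, Polynomial.eval_finsetSum, Polynomial.eval_mul, Polynomial.eval_pow, Polynomial.eval_X]
    rw [← h4, ← Finset.sum_add_distrib]
    exact Finset.sum_congr rfl fun i _ => by ring

lemma span_top_of_card {m n : ℕ} (a : Fin m → Fin n → ℝ) (B : Finset (Fin m))
    (hB : LinearIndepOn ℝ a (B : Set (Fin m))) (hc : B.card = n) :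
    Submodule.span ℝ (a '' (B : Set (Fin m))) = ⊤ := by
  have h := LinearIndependent.span_eq_top_of_card_eq_finrank' (K := ℝ)
    (b := fun i : B => a i) hB (by simp [hc])
  rw [← h]
  congr 1
  ext x; simp

lemma span_ne_top_of_card {m n : ℕ} (a : Fin m → Fin n → ℝ) (B : Finset (Fin m))
    (hc : B.card < n) :
    Submodule.span ℝ (a '' (B : Set (Fin m))) ≠ ⊤ := by
  classical
  intro h
  have h1 := finrank_span_finset_le_card (R := ℝ) (B.image a)
  rw [Finset.coe_image, Set.finrank, h] at h1
  simp at h1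
  have := Finset.card_image_le (s := B) (f := a)
  omega

lemma eq_zero_of_span_top {m n : ℕ} (a : Fin m → Fin n → ℝ) (S : Set (Fin m))
    (hS : Submodule.span ℝ (a '' S) = ⊤) (u : Fin n → ℝ) (hu : ∀ i ∈ S, a i ⬝ᵥ u = 0) :
    u = 0 := by
  have : ∀ x : Fin n → ℝ, x ∈ Submodule.span ℝ (a '' S) → x ⬝ᵥ u = 0 := by
    intro x hx
    induction hx using Submodule.span_induction with
    | mem x h => obtain ⟨i, hi, rfl⟩ := h; exact hu i hi
    | zero => simp
    | add x y _ _ hx hy => rw [add_dotProduct, hx, hy, add_zero]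
    | smul c x _ hx => rw [smul_dotProduct, hx, smul_zero]
  have h := this u (by rw [hS]; trivial)
  exact dotProduct_self_eq_zero.1 h

lemma exists_perp {m n : ℕ} (a : Fin m → Fin n → ℝ) (S : Set (Fin m))
    (hS : Submodule.span ℝ (a '' S) ≠ ⊤) :
    ∃ u : Fin n → ℝ, u ≠ 0 ∧ ∀ i ∈ S, a i ⬝ᵥ u = 0 := by
  obtain ⟨f, hf, hle⟩ := Submodule.exists_le_ker_of_lt_top _ (lt_top_iff_ne_top.2 hS)
  have key : ∀ x : Fin n → ℝ, f x = x ⬝ᵥ (fun j => f (Pi.single j 1)) := by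
    intro x
    conv_lhs => rw [pi_eq_sum_univ' x]
    simp [dotProduct, map_sum]
  refine ⟨fun j => f (Pi.single j 1), ?_, ?_⟩
  · intro h0
    apply hf
    ext x
    simp [h0] at key ⊢
    exact key _
  · intro i hi
    rw [← key]
    exact hle (Submodule.subset_span ⟨i, hi, rfl⟩)

lemma perp_span {ι : Type*} {n : ℕ} (a : ι → Fin n → ℝ) (S : Set ι) (u : Fin n → ℝ)
    (hu : ∀ i ∈ S, a i ⬝ᵥ u = 0) (x : Fin n → ℝ) (hx : x ∈ Submodule.span ℝ (a '' S)) :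
    x ⬝ᵥ u = 0 := by
  induction hx using Submodule.span_induction with
  | mem x h => obtain ⟨i, hi, rfl⟩ := h; exact hu i hi
  | zero => simp
  | add x y _ _ hx hy => rw [add_dotProduct, hx, hy, add_zero]
  | smul c x _ hx => rw [smul_dotProduct, hx, smul_zero]

lemma ray_exit {m n : ℕ} (a : Fin m → Fin n → ℝ) (β : Fin m → ℝ)
    (hrec : ∀ u : Fin n → ℝ, u ≠ 0 → ∃ i, 0 < a i ⬝ᵥ u)
    (q u : Fin n → ℝ) (hq : ∀ i, a i ⬝ᵥ q ≤ β i) (hu : u ≠ 0) :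
    ∃ t : ℝ, 0 ≤ t ∧ (∀ i, a i ⬝ᵥ (q + t • u) ≤ β i) ∧
      ∃ i, 0 < a i ⬝ᵥ u ∧ a i ⬝ᵥ (q + t • u) = β i := by
  classical
  obtain ⟨i0, hi0⟩ := hrec u hu
  obtain ⟨i, hi, hmin⟩ := Finset.exists_min_image (Finset.univ.filter fun i => 0 < a i ⬝ᵥ u)
    (fun i => (β i - a i ⬝ᵥ q) / (a i ⬝ᵥ u)) ⟨i0, by simp [hi0]⟩
  have hi' : 0 < a i ⬝ᵥ u := (Finset.mem_filter.1 hi).2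
  have ht : 0 ≤ (β i - a i ⬝ᵥ q) / (a i ⬝ᵥ u) := div_nonneg (by linarith [hq i]) hi'.le
  refine ⟨(β i - a i ⬝ᵥ q) / (a i ⬝ᵥ u), ht, ?_, i, hi', ?_⟩
  · intro j
    rw [dotProduct_add, dotProduct_smul, smul_eq_mul]
    by_cases hj : 0 < a j ⬝ᵥ u
    · have := hmin j (by simp [hj])
      rw [le_div_iff₀ hj] at this
      linarith
    · have := mul_nonneg ht (by linarith : 0 ≤ - (a j ⬝ᵥ u))
      linarith [hq j]
  · rw [dotProduct_add, dotProduct_smul, smul_eq_mul, div_mul_cancel₀ _ hi'.ne']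
    ring

lemma cover {m n : ℕ} (a : Fin m → Fin n → ℝ) (β : Fin m → ℝ)
    (hrec : ∀ u : Fin n → ℝ, u ≠ 0 → ∃ i, 0 < a i ⬝ᵥ u)
    (q : Finset (Fin m) → Fin n → ℝ)
    (hq : ∀ I : Finset (Fin m), (∃ x, (∀ i, a i ⬝ᵥ x ≤ β i) ∧ ∀ i ∈ I, a i ⬝ᵥ x = β i) →
      (∀ i, a i ⬝ᵥ q I ≤ β i) ∧ ∀ i ∈ I, a i ⬝ᵥ q I = β i) (d : ℕ) :
    ∀ (I : Finset (Fin m)) (x : Fin n → ℝ), LinearIndepOn ℝ a (I : Set (Fin m)) →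
      I.card + d = n → (∀ i, a i ⬝ᵥ x ≤ β i) → (∀ i ∈ I, a i ⬝ᵥ x = β i) →
      ∃ B : Finset (Fin m), B.card = n ∧ LinearIndepOn ℝ a (B : Set (Fin m)) ∧ I ⊆ B ∧
        (∃ v, (∀ i, a i ⬝ᵥ v ≤ β i) ∧ ∀ i ∈ B, a i ⬝ᵥ v = β i) ∧
        ∃ (g : Fin (d+1) → Finset (Fin m)) (w : Fin (d+1) → ℝ), (∀ k, g k ⊆ B) ∧
          (∀ k i, a i ⬝ᵥ q (g k) ≤ β i) ∧ (∀ k, 0 ≤ w k) ∧ ∑ k, w k = 1 ∧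
          x = ∑ k, w k • q (g k) := by
  classical
  induction d with
  | zero =>
    intro I x hI hc hx hxI
    obtain ⟨h1, h2⟩ := hq I ⟨x, hx, hxI⟩
    refine ⟨I, by simpa using hc, hI, subset_rfl, ⟨x, hx, hxI⟩, fun _ => I, fun _ => 1, ?_, ?_, ?_, ?_, ?_⟩
    · intro k; exact subset_rfl
    · intro k; exact h1
    · intro k; norm_num
    · simp
    · have : x - q I = 0 := by
        apply eq_zero_of_span_top a I (span_top_of_card a I hI (by simpa using hc))
        intro i hi
        rw [dotProduct_sub, hxI i hi, h2 i hi, sub_self]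
      simp [sub_eq_zero.1 this]
  | succ d ih =>
    intro I x hI hc hx hxI
    obtain ⟨h1, h2⟩ := hq I ⟨x, hx, hxI⟩
    obtain ⟨u, hu, huI, θ', hxu⟩ : ∃ u : Fin n → ℝ, u ≠ 0 ∧ (∀ i ∈ I, a i ⬝ᵥ u = 0) ∧
        ∃ θ : ℝ, (θ = 0 ∨ θ = 1) ∧ x = q I + θ • u := by
      by_cases hxq : x = q I
      · obtain ⟨u, hu, hu'⟩ := exists_perp a I (span_ne_top_of_card a I (by omega))
        exact ⟨u, hu, hu', 0, Or.inl rfl, by simp [hxq]⟩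
      · refine ⟨x - q I, sub_ne_zero.2 hxq, ?_, 1, Or.inr rfl, by simp⟩
        intro i hi
        rw [dotProduct_sub, hxI i hi, h2 i hi, sub_self]
    obtain ⟨t, ht, hP, i, hiu, hti⟩ := ray_exit a β hrec (q I) u h1 hu
    have hins : LinearIndepOn ℝ a ((insert i I : Finset (Fin m)) : Set (Fin m)) := by
      rw [Finset.coe_insert]
      apply hI.insert
      intro hmem
      have := perp_span a I u huI _ hmem
      linarith
    have hiI : i ∉ I := fun h => by have := huI i h; linarith
    obtain ⟨B, hB1, hB2, hB3, hB4, g, w, hg, hgP, hw, hw1, hxw⟩ := ih (insert i I) (q I + t • u) hins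
      (by rw [Finset.card_insert_of_notMem hiI]; omega) hP (by
        intro j hj
        rcases Finset.mem_insert.1 hj with rfl | hj
        · exact hti
        · rw [dotProduct_add, dotProduct_smul, huI j hj, h2 j hj]; simp)
    obtain ⟨θ, hθ0, hθ1, hxθ⟩ : ∃ θ : ℝ, 0 ≤ θ ∧ θ ≤ 1 ∧ x = q I + θ • (t • u) := by
      rcases hxu with ⟨rfl | rfl, hx'⟩
      · exact ⟨0, le_rfl, zero_le_one, by simpa using hx'⟩
      · have h1t : 1 ≤ t := by
          have := hx i
          rw [hx', ← hti, dotProduct_add, dotProduct_add, dotProduct_smul, dotProduct_smul] at this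
          simp only [smul_eq_mul] at this
          have h' : 1 * (a i ⬝ᵥ u) ≤ t * (a i ⬝ᵥ u) := by linarith
          exact le_of_mul_le_mul_right h' hiu
        refine ⟨1/t, by positivity, by rw [div_le_one (by linarith)]; exact h1t, ?_⟩
        rw [smul_smul, one_div_mul_cancel (by linarith), ← hx']
    refine ⟨B, hB1, hB2, (Finset.subset_insert i I).trans hB3, hB4, Fin.cons I g,
      Fin.cons (1-θ) (fun k => θ * w k), ?_, ?_, ?_, ?_, ?_⟩
    · intro k
      refine Fin.cases ?_ (fun k => ?_) k
      · exact (Finset.subset_insert i I).trans hB3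
      · exact hg k
    · intro k
      refine Fin.cases ?_ (fun k => ?_) k
      · exact h1
      · exact hgP k
    · intro k
      refine Fin.cases ?_ (fun k => ?_) k
      · simpa using hθ1
      · simpa using mul_nonneg hθ0 (hw k)
    · rw [Fin.sum_univ_succ]
      simp [← Finset.mul_sum, hw1]
    · rw [Fin.sum_univ_succ]
      simp only [Fin.cons_zero, Fin.cons_succ, mul_smul, ← Finset.smul_sum, ← hxw]
      rw [hxθ, smul_add, sub_smul, one_smul]
      abel

lemma exists_generic_c {m n : ℕ} (a : Fin m → Fin n → ℝ) :
    ∃ c : Fin n → ℝ, ∀ J : Finset (Fin m), J.card < n →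
      c ∉ Submodule.span ℝ (a '' (J : Set (Fin m))) := by
  classical
  let s : Finset (Subspace ℝ (Fin n → ℝ)) :=
    (Finset.univ.filter fun J : Finset (Fin m) => J.card < n).image
      fun J : Finset (Fin m) => Submodule.span ℝ (a '' (J : Set (Fin m)))
  have hs : ⊤ ∉ s := by
    intro h
    obtain ⟨J, hJ, hJt⟩ := Finset.mem_image.1 h
    exact span_ne_top_of_card a J (Finset.mem_filter.1 hJ).2 hJt
  have := Subspace.biUnion_ne_univ_of_top_notMem hs
  obtain ⟨c, hc⟩ := (Set.ne_univ_iff_exists_notMem _).1 this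
  refine ⟨c, fun J hJ hmem => hc ?_⟩
  simp only [Set.mem_iUnion]
  exact ⟨_, Finset.mem_image.2 ⟨J, by simpa using hJ, rfl⟩, hmem⟩

lemma card_small_subsets (m h : ℕ) (hm : 1 ≤ m) :
    (Finset.univ.filter fun M : Finset (Fin m) => M.card ≤ h).card ≤ (h+1) * m ^ h := by
  classical
  have : (Finset.univ.filter fun M : Finset (Fin m) => M.card ≤ h) ⊆
      (Finset.range (h+1)).biUnion fun j => Finset.powersetCard j Finset.univ := by
    intro M hM
    simp at hM
    simp
    omega
  refine (Finset.card_le_card this).trans (Finset.card_biUnion_le.trans ?_)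
  refine (Finset.sum_le_card_nsmul _ _ (m^h) ?_).trans (by simp)
  intro j hj
  rw [Finset.card_powersetCard]
  simp at hj
  refine (Nat.choose_le_pow _ _).trans ?_
  simp
  exact Nat.pow_le_pow_right hm (by omega)

lemma card_bases {m n : ℕ} (hm : 1 ≤ m) (a : Fin m → Fin n → ℝ) (β : Fin m → ℝ)
    (hgen : ∀ v : Fin n → ℝ, LinearIndepOn ℝ a {i | a i ⬝ᵥ v = β i})
    (𝓑 : Finset (Finset (Fin m)))
    (h𝓑 : ∀ B ∈ 𝓑, B.card = n ∧ LinearIndepOn ℝ a (B : Set (Fin m)) ∧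
        ∃ v, (∀ i, a i ⬝ᵥ v ≤ β i) ∧ ∀ i ∈ B, a i ⬝ᵥ v = β i) :
    𝓑.card ≤ 2 * ((n/2+1) * m ^ (n/2)) := by
  classical
  obtain ⟨c, hc⟩ := exists_generic_c a
  have key : ∀ B : Finset (Fin m), ∃ (p : Bool × Finset (Fin m)) (v : Fin n → ℝ), B ∈ 𝓑 →
      p.2.card ≤ n/2 ∧ (∀ i, a i ⬝ᵥ v ≤ β i) ∧ (∀ i, i ∈ B ↔ a i ⬝ᵥ v = β i) ∧ p.2 ⊆ B ∧
      ∀ x, (∀ i, a i ⬝ᵥ x ≤ β i) → (∀ i ∈ p.2, a i ⬝ᵥ x = β i) →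
        (if p.1 then c ⬝ᵥ v ≤ c ⬝ᵥ x else c ⬝ᵥ x ≤ c ⬝ᵥ v) → x = v := by
    intro B
    by_cases hB : B ∈ 𝓑
    swap
    · exact ⟨(true, ∅), 0, fun h => absurd h hB⟩
    obtain ⟨hcard, hli, v, hv, hvB⟩ := h𝓑 B hB
    have hspan := span_top_of_card a B hli hcard
    have htight : ∀ i, i ∈ B ↔ a i ⬝ᵥ v = β i := by
      have hsub : B ⊆ Finset.univ.filter fun i => a i ⬝ᵥ v = β i := by
        intro i hi; simp [hvB i hi]
      have hle : (Finset.univ.filter fun i => a i ⬝ᵥ v = β i).card ≤ n := by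
        have := hgen v
        have h2 : LinearIndepOn ℝ a ((Finset.univ.filter fun i => a i ⬝ᵥ v = β i : Finset (Fin m)) : Set (Fin m)) := by
          simpa using this
        have h3 := LinearIndependent.fintype_card_le_finrank h2
        simpa using h3
      have := Finset.eq_of_subset_of_card_le hsub (by omega)
      intro i
      rw [this]; simp
    obtain ⟨y, hy⟩ : ∃ y : Fin m → ℝ, ∑ i ∈ B, y i • a i = c := by
      have : c ∈ Submodule.span ℝ (a '' (B : Set (Fin m))) := by rw [hspan]; trivial
      obtain ⟨f, hf⟩ := (Submodule.mem_span_image_finset_iff_exists_fun ℝ).1 this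
      refine ⟨fun i => if h : i ∈ B then f ⟨i, h⟩ else 0, ?_⟩
      rw [← hf, ← Finset.sum_attach]
      refine Finset.sum_congr rfl fun i _ => ?_
      simp
    have hy0 : ∀ i ∈ B, y i ≠ 0 := by
      intro i hi h0
      apply hc (B.erase i) (by
        have := Finset.card_erase_lt_of_mem hi
        omega)
      rw [← hy, ← Finset.add_sum_erase B _ hi, h0, zero_smul, zero_add]
      exact Submodule.sum_mem _ fun k hk => Submodule.smul_mem _ _
        (Submodule.subset_span ⟨k, hk, rfl⟩)
    have hcx : ∀ x, c ⬝ᵥ x - c ⬝ᵥ v = ∑ i ∈ B, y i * (a i ⬝ᵥ x - β i) := by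
      intro x
      rw [← dotProduct_sub, ← hy, sum_dotProduct]
      refine Finset.sum_congr rfl fun i hi => ?_
      rw [smul_dotProduct, dotProduct_sub, hvB i hi, smul_eq_mul]
    have fin : ∀ x, (∀ i ∈ B, y i * (a i ⬝ᵥ x - β i) = 0) → x = v := by
      intro x hx
      have : x - v = 0 := by
        apply eq_zero_of_span_top a B hspan
        intro i hi
        rcases mul_eq_zero.1 (hx i hi) with h | h
        · exact absurd h (hy0 i hi)
        · rw [dotProduct_sub, hvB i hi, h]
      exact sub_eq_zero.1 this
    have hsum : (B.filter fun i => 0 < y i).card + (B.filter fun i => ¬ 0 < y i).card = n := by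
      rw [Finset.card_filter_add_card_filter_not, hcard]
    by_cases hpos : (B.filter fun i => 0 < y i).card ≤ n/2
    · refine ⟨(false, B.filter fun i => 0 < y i), v, fun _ => ⟨hpos, hv, htight, Finset.filter_subset _ _, ?_⟩⟩
      intro x hx hxM hle
      simp only [Bool.false_eq_true, if_false] at hle
      apply fin
      have hnn : ∀ i ∈ B, 0 ≤ y i * (a i ⬝ᵥ x - β i) := by
        intro i hi
        by_cases hyi : 0 < y i
        · rw [hxM i (by simp [hi, hyi])]; simp
        · exact mul_nonneg_of_nonpos_of_nonpos (by linarith) (by linarith [hx i])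
      refine (Finset.sum_eq_zero_iff_of_nonneg hnn).1 ?_
      have := Finset.sum_nonneg hnn
      have := hcx x
      linarith
    · refine ⟨(true, B.filter fun i => ¬ 0 < y i), v, fun _ => ⟨by simp only; omega, hv, htight, Finset.filter_subset _ _, ?_⟩⟩
      intro x hx hxM hle
      simp only [if_true] at hle
      apply fin
      have hnn : ∀ i ∈ B, y i * (a i ⬝ᵥ x - β i) ≤ 0 := by
        intro i hi
        by_cases hyi : 0 < y i
        · exact mul_nonpos_of_nonneg_of_nonpos hyi.le (by linarith [hx i])
        · rw [hxM i (by simp only [Finset.mem_filter]; exact ⟨hi, hyi⟩)]; simp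
      refine (Finset.sum_eq_zero_iff_of_nonpos hnn).1 ?_
      have := Finset.sum_nonpos hnn
      have := hcx x
      linarith
  choose p v hpv using key
  have hle : 𝓑.card ≤ ((Finset.univ : Finset Bool) ×ˢ
      (Finset.univ.filter fun M : Finset (Fin m) => M.card ≤ n/2)).card := by
    apply Finset.card_le_card_of_injOn p
    · intro B hB
      have := (hpv B hB).1
      simp [this]
    · intro B hB B' hB' heq
      obtain ⟨h1, h2, h3, h4, h5⟩ := hpv B hB
      obtain ⟨h1', h2', h3', h4', h5'⟩ := hpv B' hB'
      have hvv : v B = v B' := by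
        have e1 := h5 (v B') h2' (fun i hi => (h3' i).1 (h4' (heq ▸ hi)))
        have e2 := h5' (v B) h2 (fun i hi => (h3 i).1 (h4 (heq.symm ▸ hi)))
        rw [← heq] at e2
        by_cases hs : (p B).1 = true
        · simp only [hs, if_true] at e1 e2
          rcases le_total (c ⬝ᵥ v B) (c ⬝ᵥ v B') with h | h
          · exact (e1 h).symm
          · exact e2 h
        · simp only [hs] at e1 e2
          rcases le_total (c ⬝ᵥ v B) (c ⬝ᵥ v B') with h | h
          · exact e2 (by simpa using h)
          · exact (e1 (by simpa using h)).symm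
      ext i
      rw [h3 i, h3' i, hvv]
  refine hle.trans ?_
  rw [Finset.card_product]
  simp only [Finset.card_univ, Fintype.card_bool]
  exact Nat.mul_le_mul_left _ (card_small_subsets m (n/2) hm)

section
attribute [local instance] Matrix.seminormedAddCommGroup

lemma siegel_perp {m n : ℕ} (hn : 1 ≤ n) (A : Matrix (Fin m) (Fin n) ℤ) (α : ℝ) (hα : 1 ≤ α)
    (hA : ∀ i j, |(A i j : ℝ)| ≤ α) (S : Set (Fin m))
    (hS : Submodule.span ℝ ((fun i j => (A i j : ℝ)) '' S) ≠ ⊤) :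
    ∃ u : Fin n → ℤ, u ≠ 0 ∧ (∀ i ∈ S, (fun j => (A i j : ℝ)) ⬝ᵥ (fun j => (u j : ℝ)) = 0) ∧
      ∀ j, |(u j : ℝ)| ≤ (n * α) ^ n := by
  classical
  obtain ⟨κ, f, hf, hspan, hli⟩ := exists_linearIndependent' ℝ (fun i : S => (fun j => (A i j : ℝ)))
  have : Finite κ := Finite.of_injective f hf
  have : Fintype κ := Fintype.ofFinite κ
  have hran : Set.range (fun i : S => (fun j => (A i j : ℝ))) = (fun i j => (A i j : ℝ)) '' S := by
    ext x; simp
  have hcard : Fintype.card κ < n := by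
    have h1 := hli.fintype_card_le_finrank
    simp at h1
    refine lt_of_le_of_ne h1 fun h => hS ?_
    rw [← hran, ← hspan]
    exact hli.span_eq_top_of_card_eq_finrank' (by simp [h])
  have hnα : 1 ≤ (n : ℝ) * α := one_le_mul_of_one_le_of_one_le (by exact_mod_cast hn) hα
  have main : ∃ u : Fin n → ℤ, u ≠ 0 ∧
      (∀ k : κ, (fun j => (A (f k) j : ℝ)) ⬝ᵥ (fun j => (u j : ℝ)) = 0) ∧
      ∀ j, |(u j : ℝ)| ≤ (n * α) ^ n := by
    rcases Nat.eq_zero_or_pos (Fintype.card κ) with h0 | hpos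
    · have := Fintype.card_eq_zero_iff.1 h0
      refine ⟨fun _ => 1, ?_, fun k => isEmptyElim k, fun j => ?_⟩
      · intro h
        have := congrFun h ⟨0, hn⟩
        simp at this
      · simpa using one_le_pow₀ hnα
    · obtain ⟨t, ht0, htA, htn⟩ := Int.Matrix.exists_ne_zero_int_vec_norm_le
        (A.submatrix (fun k : κ => (f k).1) id) (by simpa using hcard) hpos
      refine ⟨t, ht0, ?_, ?_⟩
      · intro k
        have := congrFun htA k
        simp only [Matrix.mulVec, dotProduct, Pi.zero_apply] at this
        simp only [dotProduct]
        exact_mod_cast this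
      · intro j
        have h1 : |(t j : ℝ)| ≤ ‖t‖ := by
          have := norm_le_pi_norm t j
          rwa [Int.norm_eq_abs] at this
        refine h1.trans (htn.trans ?_)
        have h2 : max 1 ‖(A.submatrix (fun k : κ => (f k).1) id)‖ ≤ α := by
          apply max_le hα
          refine (Matrix.norm_le_iff (by linarith)).2 ?_
          intro i j
          rw [Int.norm_eq_abs]
          exact hA _ _
        simp only [Fintype.card_fin]
        have hc1 : (Fintype.card κ : ℝ) + 1 ≤ n := by exact_mod_cast hcard
        calc ((n:ℝ) * max 1 ‖(A.submatrix (fun k : κ => (f k).1) id)‖) ^ ((Fintype.card κ : ℝ) / (n - Fintype.card κ))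
            ≤ ((n:ℝ) * α) ^ ((Fintype.card κ : ℝ) / (n - Fintype.card κ)) := by
              apply Real.rpow_le_rpow
              · positivity
              · gcongr
              · apply div_nonneg <;> [positivity; linarith]
          _ ≤ ((n:ℝ) * α) ^ (n : ℝ) := by
              apply Real.rpow_le_rpow_of_exponent_le hnα
              rw [div_le_iff₀ (by linarith)]
              have : (0:ℝ) ≤ n := by positivity
              nlinarith
          _ = _ := Real.rpow_natCast _ _
  obtain ⟨u, hu0, huk, hub⟩ := main
  refine ⟨u, hu0, ?_, hub⟩
  intro i hi
  apply perp_span ((fun i : S => (fun j => (A i j : ℝ))) ∘ f) Set.univ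
  · intro k _
    exact huk k
  · rw [Set.image_univ, hspan]
    exact Submodule.subset_span ⟨⟨i, hi⟩, rfl⟩

end

lemma cramer_bound {m n : ℕ} (A : Matrix (Fin m) (Fin n) ℤ) (α : ℝ) (hα : 1 ≤ α)
    (hA : ∀ i j, |(A i j : ℝ)| ≤ α) (S : Set (Fin m))
    (hS : Submodule.span ℝ ((fun i j => (A i j : ℝ)) '' S) = ⊤) (T : ℝ)
    (u : Fin n → ℝ) (hu : ∀ i ∈ S, |(fun j => (A i j : ℝ)) ⬝ᵥ u| ≤ T) (j : Fin n) :
    |u j| ≤ n * ((n.factorial * α ^ n) * T) := by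
  classical
  obtain ⟨κ, f, hf, hspan, hli⟩ := exists_linearIndependent' ℝ (fun i : S => (fun j => (A i j : ℝ)))
  have : Finite κ := Finite.of_injective f hf
  have : Fintype κ := Fintype.ofFinite κ
  have hran : Set.range (fun i : S => (fun j => (A i j : ℝ))) = (fun i j => (A i j : ℝ)) '' S := by
    ext x; simp
  rw [hran, hS] at hspan
  have hcard : Fintype.card κ = n := by
    have := Module.finrank_eq_card_basis (Module.Basis.mk hli hspan.ge)
    simpa using this.symm
  let e : Fin n ≃ κ := (finCongr hcard.symm).trans (Fintype.equivFin κ).symm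
  let M : Matrix (Fin n) (Fin n) ℤ := fun k j => A (f (e k)) j
  let MR : Matrix (Fin n) (Fin n) ℝ := M.map (fun x : ℤ => (x : ℝ))
  have hMR : LinearIndependent ℝ MR.row := hli.comp e e.injective
  have hdet : MR.det ≠ 0 := by
    have := Matrix.linearIndependent_rows_iff_isUnit.1 hMR
    rw [Matrix.isUnit_iff_isUnit_det] at this
    exact this.ne_zero
  have hdetZ : MR.det = ((M.det : ℤ) : ℝ) := by
    exact (RingHom.map_det (Int.castRingHom ℝ) M).symm
  have hdet1 : 1 ≤ |MR.det| := by
    rw [hdetZ] at hdet ⊢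
    have : M.det ≠ 0 := by exact_mod_cast hdet
    exact_mod_cast Int.one_le_abs this
  have hadj : ∀ i k, |MR.adjugate i k| ≤ n.factorial * α ^ n := by
    intro i k
    rw [Matrix.adjugate_apply]
    have := Matrix.det_le (A := MR.updateRow k (Pi.single i 1)) (abv := AbsoluteValue.abs) (x := α) (by
      intro r s
      rw [Matrix.updateRow_apply]
      simp only [AbsoluteValue.abs_apply]
      split_ifs
      · rw [Pi.single_apply]; split_ifs <;> simp <;> linarith
      · exact hA _ _)
    simpa using this
  have hsolve : MR.det * u j = ∑ k, MR.adjugate j k * (MR.mulVec u) k := by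
    have h1 : (MR.adjugate.mulVec (MR.mulVec u)) j = MR.det * u j := by
      rw [Matrix.mulVec_mulVec, Matrix.adjugate_mul]
      simp [Matrix.smul_mulVec]
    rw [← h1]; rfl
  calc |u j| ≤ |MR.det| * |u j| := le_mul_of_one_le_left (abs_nonneg _) hdet1
    _ = |∑ k, MR.adjugate j k * (MR.mulVec u) k| := by rw [← abs_mul, hsolve]
    _ ≤ ∑ k, |MR.adjugate j k * (MR.mulVec u) k| := Finset.abs_sum_le_sum_abs _ _
    _ ≤ ∑ k : Fin n, ((n.factorial * α ^ n) * T) := by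
        apply Finset.sum_le_sum
        intro k _
        rw [abs_mul]
        apply mul_le_mul (hadj j k) _ (abs_nonneg _) (by positivity)
        exact hu _ (f (e k)).2
    _ = _ := by simp

lemma near_span {m n : ℕ} (hn : 1 ≤ n) (A : Matrix (Fin m) (Fin n) ℤ) (b : Fin m → ℤ)
    (α : ℝ) (hα : 1 ≤ α) (hA : ∀ i j, |(A i j : ℝ)| ≤ α) (x : Fin n → ℝ)
    (hx : x ∈ vertN m n A b) :
    Submodule.span ℝ ((fun i j => (A i j : ℝ)) ''
      {i | (b i : ℝ) - (fun j => (A i j : ℝ)) ⬝ᵥ x < n * (α * (n * α) ^ n)}) = ⊤ := by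
  by_contra hne
  obtain ⟨u, hu0, huS, hub⟩ := siegel_perp hn A α hα hA _ hne
  have hxI : x ∈ intPoints m n A b := extremePoints_convexHull_subset hx
  have hau : ∀ i, |(fun j => (A i j : ℝ)) ⬝ᵥ (fun j => (u j : ℝ))| ≤ n * (α * (n * α) ^ n) := by
    intro i
    refine (Finset.abs_sum_le_sum_abs _ _).trans ?_
    refine (Finset.sum_le_card_nsmul _ _ (α * (n * α) ^ n) ?_).trans (by simp)
    intro j _
    rw [abs_mul]
    exact mul_le_mul (hA i j) (hub j) (abs_nonneg _) (by linarith)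
  have hmem : ∀ s : ℤ, |(s : ℝ)| = 1 → x + (s : ℝ) • (fun j => (u j : ℝ)) ∈ intPoints m n A b := by
    intro s hs
    refine ⟨fun j => ?_, fun i => ?_⟩
    · obtain ⟨z, hz⟩ := hxI.1 j
      exact ⟨z + s * u j, by simp [hz]⟩
    · change (fun j => (A i j : ℝ)) ⬝ᵥ (x + (s : ℝ) • (fun j => (u j : ℝ))) ≤ b i
      rw [dotProduct_add, dotProduct_smul, smul_eq_mul]
      have h1 : (fun j => (A i j : ℝ)) ⬝ᵥ x ≤ b i := hxI.2 i
      by_cases hi : (b i : ℝ) - (fun j => (A i j : ℝ)) ⬝ᵥ x < n * (α * (n * α) ^ n)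
      · rw [huS i hi]; simpa using h1
      · have h2 := hau i
        have h3 : (s:ℝ) * ((fun j => (A i j : ℝ)) ⬝ᵥ (fun j => (u j : ℝ))) ≤ n * (α * (n * α) ^ n) := by
          refine (le_abs_self _).trans ?_
          rw [abs_mul, hs, one_mul]; exact h2
        linarith
  have h1 := hmem 1 (by simp)
  have h2 := hmem (-1) (by simp)
  have := (mem_extremePoints.1 hx).2 _ (subset_convexHull ℝ _ h1) _ (subset_convexHull ℝ _ h2)
    ⟨1/2, 1/2, by norm_num, by norm_num, by norm_num, by
      ext j; simp; ring⟩
  apply hu0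
  funext j
  have := congrFun this.1 j
  simpa using this

lemma dist_bound {m n : ℕ} (hn : 1 ≤ n) (A : Matrix (Fin m) (Fin n) ℤ) (b : Fin m → ℤ)
    (α : ℝ) (hα : 1 ≤ α) (hA : ∀ i j, |(A i j : ℝ)| ≤ α) (β : Fin m → ℝ)
    (hβ : ∀ i, (b i : ℝ) < β i ∧ β i < b i + 1/2)
    (p : Fin (n+1) → Fin n → ℝ) (hp : ∀ k i, (fun j => (A i j : ℝ)) ⬝ᵥ p k ≤ β i)
    (x : Fin n → ℝ) (hx : x ∈ vertN m n A b) (w : Fin (n+1) → ℝ) (hw : ∀ k, 0 ≤ w k)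
    (hs : ∀ i, β i - (fun j => (A i j : ℝ)) ⬝ᵥ x = ∑ k, w k * (β i - (fun j => (A i j : ℝ)) ⬝ᵥ p k))
    (k0 : Fin (n+1)) (hk0 : 1 ≤ (n + 1) * w k0) (j : Fin n) :
    |p k0 j - x j| ≤ n * ((n.factorial * α ^ n) * ((n+1) * (n * (α * (n * α) ^ n) + 1))) := by
  have hspan := near_span hn A b α hα hA x hx
  refine cramer_bound A α hα hA _ hspan _ (p k0 - x) ?_ j
  intro i hi
  have hi' : (b i : ℝ) - (fun j => (A i j : ℝ)) ⬝ᵥ x < n * (α * (n * α) ^ n) := hi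
  have hxI : x ∈ intPoints m n A b := extremePoints_convexHull_subset hx
  have hxi : (fun j => (A i j : ℝ)) ⬝ᵥ x ≤ b i := hxI.2 i
  set R := (n:ℝ) * (α * (n * α) ^ n)
  rw [dotProduct_sub]
  have h1 := hβ i
  have h2 := hp k0 i
  have h3 : w k0 * (β i - (fun j => (A i j : ℝ)) ⬝ᵥ p k0) ≤ β i - (fun j => (A i j : ℝ)) ⬝ᵥ x := by
    rw [hs i]
    exact Finset.single_le_sum (f := fun k => w k * (β i - (fun j => (A i j : ℝ)) ⬝ᵥ p k))
      (fun k _ => mul_nonneg (hw k) (by linarith [hp k i])) (Finset.mem_univ k0)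
  have hn0 : (1:ℝ) ≤ n + 1 := by linarith [(Nat.cast_nonneg n : (0:ℝ) ≤ n)]
  have h4 : β i - (fun j => (A i j : ℝ)) ⬝ᵥ p k0 ≤ (n+1) * (R + 1) := by
    have h5 : 1 * (β i - (fun j => (A i j : ℝ)) ⬝ᵥ p k0) ≤
        ((n+1) * w k0) * (β i - (fun j => (A i j : ℝ)) ⬝ᵥ p k0) :=
      mul_le_mul_of_nonneg_right hk0 (by linarith)
    have h6 : (n+1) * (w k0 * (β i - (fun j => (A i j : ℝ)) ⬝ᵥ p k0)) ≤ (n+1) * (R+1) :=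
      mul_le_mul_of_nonneg_left (by linarith) (by linarith)
    linarith
  have h7 : R + 1 ≤ (n+1) * (R+1) := le_mul_of_one_le_left (by linarith) hn0
  rw [abs_le]
  constructor <;> linarith

lemma log_class (r r' : ℝ) (hr' : 0 ≤ r')
    (h : Nat.log 2 ⌊r⌋₊ = Nat.log 2 ⌊r'⌋₊) : -2 ≤ 2 * r' - r := by
  have h1 := Nat.lt_floor_add_one r
  have h2 := Nat.floor_le hr'
  have h3 : ⌊r⌋₊ < 2 ^ (Nat.log 2 ⌊r⌋₊ + 1) := Nat.lt_pow_succ_log_self (by norm_num) _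
  by_cases h0 : ⌊r'⌋₊ = 0
  · rw [h, h0] at h3
    have : (⌊r⌋₊ : ℝ) ≤ 1 := by
      have : ⌊r⌋₊ ≤ 1 := by simp at h3; omega
      exact_mod_cast this
    linarith
  · have h4 := Nat.pow_log_le_self 2 h0
    rw [h, pow_succ] at h3
    have : (⌊r⌋₊ : ℝ) + 1 ≤ ⌊r'⌋₊ * 2 := by
      have : ⌊r⌋₊ + 1 ≤ ⌊r'⌋₊ * 2 := by omega
      exact_mod_cast this
    linarith

lemma floor_class (r r' : ℝ) (hr' : 1 ≤ r')
    (h : ⌊r⌋₊ = ⌊r'⌋₊) : 0 ≤ 2 * r' - r := by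
  have h1 := Nat.lt_floor_add_one r
  have h2 := Nat.floor_le (by linarith : 0 ≤ r')
  have h3 : (1:ℝ) ≤ ⌊r'⌋₊ := by exact_mod_cast (Nat.one_le_floor_iff _).2 hr'
  rw [h] at h1
  linarith

lemma exists_G {m : ℕ} (S : Set (Fin m)) (f : Fin m → ℝ) (hf : ∀ i, 0 ≤ f i) :
    ∃ G : ℝ, 0 ≤ G ∧ (∀ i ∈ S, f i ≤ G) ∧
      ∀ w C : ℝ, 0 ≤ C → (∀ i ∈ S, w * f i ≤ C) → w * G ≤ C := by
  classical
  by_cases hS : S.Nonempty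
  · obtain ⟨i, hi, hmax⟩ := Finset.exists_max_image (Finset.univ.filter fun i => i ∈ S) f
      (by obtain ⟨i, hi⟩ := hS; exact ⟨i, by simp [hi]⟩)
    have hi' : i ∈ S := by simpa using hi
    exact ⟨f i, hf i, fun j hj => hmax j (by simpa using hj), fun w C _ h => h i hi'⟩
  · rw [Set.not_nonempty_iff_eq_empty] at hS
    exact ⟨0, le_rfl, by simp [hS], fun w C hC _ => by simpa using hC⟩

lemma same_class {m n' : ℕ} (A : Matrix (Fin m) (Fin (n'+1)) ℤ) (b : Fin m → ℤ)
    (α : ℝ) (hα : 1 ≤ α) (hA : ∀ i j, |(A i j : ℝ)| ≤ α) (β : Fin m → ℝ)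
    (hβ : ∀ i, (b i : ℝ) < β i ∧ β i < b i + 1/2)
    (p : Fin (n'+1+1) → Fin (n'+1) → ℝ) (hp : ∀ k i, (fun j => (A i j : ℝ)) ⬝ᵥ p k ≤ β i)
    (D : ℝ) (k0 : Fin (n'+1+1)) (G : Fin (n'+1+1) → ℝ)
    (hG : ∀ k i, β i - (fun j => (A i j : ℝ)) ⬝ᵥ p k0 ≤ 3 * ((n'+1:ℕ) * (α * D)) →
      β i - (fun j => (A i j : ℝ)) ⬝ᵥ p k ≤ G k) (hG0 : ∀ k, 0 ≤ G k)
    (x : Fin (n'+1) → ℝ) (hx : x ∈ vertN m (n'+1) A b) (w : Fin (n'+1+1) → ℝ) (hw : ∀ k, 0 ≤ w k)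
    (hs : ∀ i, β i - (fun j => (A i j : ℝ)) ⬝ᵥ x = ∑ k, w k * (β i - (fun j => (A i j : ℝ)) ⬝ᵥ p k))
    (hxD : ∀ j, |p k0 j - x j| ≤ D)
    (y : Fin (n'+1) → ℝ) (hy : y ∈ vertN m (n'+1) A b) (w' : Fin (n'+1+1) → ℝ) (hw' : ∀ k, 0 ≤ w' k)
    (hs' : ∀ i, β i - (fun j => (A i j : ℝ)) ⬝ᵥ y = ∑ k, w' k * (β i - (fun j => (A i j : ℝ)) ⬝ᵥ p k))
    (hyD : ∀ j, |p k0 j - y j| ≤ D)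
    (hk0 : 0 ≤ 2 * w' k0 - w k0)
    (hl : w (k0.succAbove 0) ≤ w' (k0.succAbove 0))
    (hcl : ∀ j : Fin n',
      Nat.log 2 ⌊4 * ((n'+1:ℕ)+1) * (w (k0.succAbove j.succ) * G (k0.succAbove j.succ))⌋₊ =
      Nat.log 2 ⌊4 * ((n'+1:ℕ)+1) * (w' (k0.succAbove j.succ) * G (k0.succAbove j.succ))⌋₊) :
    x = y := by
  have hxI : x ∈ intPoints m (n'+1) A b := extremePoints_convexHull_subset hx
  have hyI : y ∈ intPoints m (n'+1) A b := extremePoints_convexHull_subset hy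
  have hnpos : (0:ℝ) < ((n'+1:ℕ):ℝ) + 1 := by positivity
  have hE : ∀ (u : Fin (n'+1) → ℝ), (∀ j, |u j| ≤ D) → ∀ i,
      |(fun j => (A i j : ℝ)) ⬝ᵥ u| ≤ (n'+1:ℕ) * (α * D) := by
    intro u hu i
    refine (Finset.abs_sum_le_sum_abs _ _).trans ?_
    refine (Finset.sum_le_card_nsmul _ _ (α * D) ?_).trans (by simp)
    intro j _
    rw [abs_mul]
    exact mul_le_mul (hA i j) (hu j) (abs_nonneg _) (by linarith)
  have hterm : ∀ k i, β i - (fun j => (A i j : ℝ)) ⬝ᵥ p k0 ≤ 3 * ((n'+1:ℕ) * (α * D)) →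
      -(1 / (2 * (((n'+1:ℕ):ℝ)+1))) ≤ (2 * w' k - w k) * (β i - (fun j => (A i j : ℝ)) ⬝ᵥ p k) := by
    intro k i hi
    have hneg : -(1 / (2 * (((n'+1:ℕ):ℝ)+1))) ≤ 0 := by
      have : 0 < 1 / (2 * (((n'+1:ℕ):ℝ)+1)) := by positivity
      linarith
    have hsl : 0 ≤ β i - (fun j => (A i j : ℝ)) ⬝ᵥ p k := by linarith [hp k i]
    by_cases hnn : 0 ≤ 2 * w' k - w k
    · exact hneg.trans (mul_nonneg hnn hsl)
    by_cases hkk : k = k0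
    · rw [hkk] at hnn; exact absurd hk0 hnn
    obtain ⟨j, rfl⟩ := Fin.exists_succAbove_eq hkk
    revert hnn hsl hkk
    refine Fin.cases ?_ (fun j => ?_) j
    · intro _ hnn _
      exfalso; apply hnn; linarith [hw' (k0.succAbove 0)]
    · intro hsl hnn _
      have h1 := log_class _ _
        (mul_nonneg (by positivity) (mul_nonneg (hw' _) (hG0 _))) (hcl j)
      have h2 := mul_le_mul_of_nonpos_left (hG (k0.succAbove j.succ) i hi)
        (by linarith : 2 * w' (k0.succAbove j.succ) - w (k0.succAbove j.succ) ≤ 0)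
      refine le_trans ?_ h2
      rw [neg_le, ← sub_nonneg]
      have h3 : 1 / (2 * (((n'+1:ℕ):ℝ)+1)) * (4 * (((n'+1:ℕ):ℝ)+1)) = 2 := by field_simp; norm_num
      have h4 : 0 ≤ (1 / (2 * (((n'+1:ℕ):ℝ)+1)) - -((2 * w' (k0.succAbove j.succ) - w (k0.succAbove j.succ)) * G (k0.succAbove j.succ))) * (4 * (((n'+1:ℕ):ℝ)+1)) := by
        rw [sub_mul, h3]
        linarith
      exact nonneg_of_mul_nonneg_left h4 (by positivity)
  have hz : ∀ i, -(1/2) ≤ β i - (fun j => (A i j : ℝ)) ⬝ᵥ ((2:ℝ) • y - x) := by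
    intro i
    by_cases hi : β i - (fun j => (A i j : ℝ)) ⬝ᵥ p k0 ≤ 3 * ((n'+1:ℕ) * (α * D))
    · have : β i - (fun j => (A i j : ℝ)) ⬝ᵥ ((2:ℝ) • y - x) =
          ∑ k, (2 * w' k - w k) * (β i - (fun j => (A i j : ℝ)) ⬝ᵥ p k) := by
        simp only [sub_mul _ _ (β i - _), mul_assoc, Finset.sum_sub_distrib, ← Finset.mul_sum]
        rw [← hs', ← hs, dotProduct_sub, dotProduct_smul, smul_eq_mul]; ring
      rw [this]
      have h := Finset.card_nsmul_le_sum Finset.univ _ _ (fun k _ => hterm k i hi)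
      refine le_trans (le_of_eq ?_) h
      rw [Finset.card_univ, Fintype.card_fin, nsmul_eq_mul, Nat.cast_add_one (n'+1)]
      field_simp
    · have h1 := abs_le.1 (hE (p k0 - x) hxD i)
      have h2 := abs_le.1 (hE (p k0 - y) hyD i)
      rw [dotProduct_sub] at h1 h2
      rw [dotProduct_sub, dotProduct_smul, smul_eq_mul]
      linarith
  have hzI : (2:ℝ) • y - x ∈ intPoints m (n'+1) A b := by
    choose X hX using hxI.1
    choose Y hY using hyI.1
    refine ⟨fun j => ⟨2 * Y j - X j, by simp [hX, hY]⟩, fun i => ?_⟩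
    have h1 := hz i
    have h2 := hβ i
    have h3 : (fun j => (A i j : ℝ)) ⬝ᵥ ((2:ℝ) • y - x) = ((∑ j, A i j * (2 * Y j - X j) : ℤ) : ℝ) := by
      simp [dotProduct, hX, hY]
    have h4 : ((∑ j, A i j * (2 * Y j - X j) : ℤ) : ℝ) < ((b i + 1 : ℤ) : ℝ) := by
      rw [← h3]; push_cast; linarith
    have h5 : (∑ j, A i j * (2 * Y j - X j) : ℤ) ≤ b i := by
      have := Int.cast_lt.1 h4
      omega
    change (fun j => (A i j : ℝ)) ⬝ᵥ ((2:ℝ) • y - x) ≤ b i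
    rw [h3]
    exact_mod_cast h5
  exact ((mem_extremePoints.1 hy).2 _ (subset_convexHull ℝ _ hxI) _ (subset_convexHull ℝ _ hzI)
    ⟨1/2, 1/2, by norm_num, by norm_num, by norm_num, by
      ext j; simp; ring⟩).1

lemma log_bound (n : ℕ) (hn : 1 ≤ n) : ∃ K : ℝ, 0 ≤ K ∧ ∀ α : ℝ, 1 ≤ α → 
    (Nat.log 2 ⌊4 * ((n:ℝ)+1) * (4 * (n * (α * (n * ((n.factorial * α ^ n) * ((n+1) * (n * (α * (n * α) ^ n) + 1)))))))⌋₊ : ℝ) + 1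
      ≤ K * Real.logb 2 (1 + α) := by
  set C : ℝ := 4 * ((n:ℝ)+1) * (4 * (n * (n * (n.factorial * ((n+1) * (n * n ^ n + 1)))))) with hC
  have hn1 : (1:ℝ) ≤ n := by exact_mod_cast hn
  have hf : (1:ℝ) ≤ n.factorial := by exact_mod_cast Nat.one_le_iff_ne_zero.2 (Nat.factorial_ne_zero n)
  have hC1 : 1 ≤ C := by
    have h0 : (1:ℝ) ≤ n * n ^ n + 1 := by
      have : (0:ℝ) ≤ n * n ^ n := by positivity
      linarith
    rw [hC]
    repeat' first | apply one_le_mul_of_one_le_of_one_le | assumption | linarith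
  refine ⟨Real.logb 2 C + (2*n+2) + 1, ?_, ?_⟩
  · have := Real.logb_nonneg (b := 2) (by norm_num) hC1
    positivity
  intro α hα
  have hl1 : 1 ≤ Real.logb 2 (1 + α) := by
    rw [Real.le_logb_iff_rpow_le (by norm_num) (by linarith)]
    norm_num; linarith
  set V := 4 * ((n:ℝ)+1) * (4 * (n * (α * (n * ((n.factorial * α ^ n) * ((n+1) * (n * (α * (n * α) ^ n) + 1))))))) with hV
  have hVC : V ≤ C * α ^ (2*n+2) := by
    have hx : (n:ℝ) * (α * (n * α) ^ n) + 1 ≤ (n * n ^ n + 1) * α ^ (n+1) := by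
      have : 1 ≤ α ^ (n+1) := one_le_pow₀ hα
      have e : (n:ℝ) * (α * (n * α) ^ n) = n * n ^ n * α ^ (n+1) := by rw [mul_pow]; ring
      rw [e]; linarith
    calc V ≤ 4 * ((n:ℝ)+1) * (4 * (n * (α * (n * ((n.factorial * α ^ n) * ((n+1) * ((n * n ^ n + 1) * α ^ (n+1)))))))) := by
          rw [hV]; gcongr
      _ = C * α ^ (2*n+2) := by rw [hC]; ring
  have hVC' : V ≤ C * (1 + α) ^ (2*n+2) := hVC.trans (by gcongr; linarith)
  have hL : (Nat.log 2 ⌊V⌋₊ : ℝ) ≤ Real.logb 2 C + (2*n+2) * Real.logb 2 (1+α) := by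
    have hr : 1 ≤ C * (1 + α) ^ (2*n+2) := one_le_mul_of_one_le_of_one_le hC1 (one_le_pow₀ (by linarith))
    have e : Real.logb 2 C + (2*n+2) * Real.logb 2 (1+α) = Real.logb 2 (C * (1+α) ^ (2*n+2)) := by
      rw [Real.logb_mul (b := 2) (x := C) (y := (1+α) ^ (2*n+2)) (by linarith) (by positivity), Real.logb_pow]
      push_cast; ring
    rw [e]
    by_cases h0 : ⌊V⌋₊ = 0
    · rw [h0]; simpa using Real.logb_nonneg (b := 2) (by norm_num) hr
    · rw [Real.le_logb_iff_rpow_le (by norm_num) (by linarith), Real.rpow_natCast]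
      have h1 : ((2 ^ Nat.log 2 ⌊V⌋₊ : ℕ) : ℝ) ≤ ⌊V⌋₊ := by exact_mod_cast Nat.pow_log_le_self 2 h0
      have h2 : (⌊V⌋₊ : ℝ) ≤ V := Nat.floor_le (by rw [hV]; positivity)
      push_cast at h1
      linarith
  have h3 := Real.logb_nonneg (b := 2) (by norm_num) hC1
  nlinarith

lemma no_recession {m n : ℕ} (a : Fin m → Fin n → ℝ) (b : Fin m → ℝ)
    (hne : {x : Fin n → ℝ | ∀ i, a i ⬝ᵥ x ≤ b i}.Nonempty)
    (hbd : Bornology.IsBounded {x : Fin n → ℝ | ∀ i, a i ⬝ᵥ x ≤ b i}) :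
    ∀ u : Fin n → ℝ, u ≠ 0 → ∃ i, 0 < a i ⬝ᵥ u := by
  intro u hu
  by_contra hcon
  push Not at hcon
  obtain ⟨x, hx⟩ := hne
  obtain ⟨C, hC⟩ := hbd.exists_norm_le
  have hu' : 0 < ‖u‖ := norm_pos_iff.2 hu
  have hC0 : 0 ≤ C := (norm_nonneg _).trans (hC x hx)
  have ht : 0 ≤ (2 * C + 1) / ‖u‖ := by positivity
  have h1 := hC (x + ((2 * C + 1) / ‖u‖) • u) (by
    intro i
    rw [dotProduct_add, dotProduct_smul, smul_eq_mul]
    have := mul_nonneg ht (by linarith [hcon i] : 0 ≤ - (a i ⬝ᵥ u))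
    linarith [hx i])
  have h2 := hC x hx
  have h3 : ‖((2 * C + 1) / ‖u‖) • u‖ ≤ ‖x + ((2 * C + 1) / ‖u‖) • u‖ + ‖x‖ := by
    have := norm_sub_le (x + ((2 * C + 1) / ‖u‖) • u) x
    simpa using this
  rw [norm_smul, Real.norm_of_nonneg ht, div_mul_cancel₀ _ hu'.ne'] at h3
  linarith

lemma main_count {m n' : ℕ} (hm : 1 ≤ m) (A : Matrix (Fin m) (Fin (n'+1)) ℤ) (b : Fin m → ℤ)
    (hrec : ∀ u : Fin (n'+1) → ℝ, u ≠ 0 → ∃ i, 0 < (fun j => (A i j : ℝ)) ⬝ᵥ u)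
    (α : ℝ) (hα : 1 ≤ α) (hA : ∀ i j, |(A i j : ℝ)| ≤ α) (D : ℝ)
    (hD : D = (n'+1:ℕ) * (((n'+1).factorial * α ^ (n'+1)) * (((n'+1:ℕ)+1) * ((n'+1:ℕ) * (α * ((n'+1:ℕ) * α) ^ (n'+1)) + 1))))
    (L : ℕ) (hL : L = Nat.log 2 ⌊4 * (((n'+1:ℕ):ℝ)+1) * (4 * ((n'+1:ℕ) * (α * D)))⌋₊) :
    (vertN m (n'+1) A b).Finite ∧ (vertN m (n'+1) A b).ncard ≤
      (2 * (((n'+1)/2+1) * m ^ ((n'+1)/2))) * (2 ^ (n'+1)) ^ (n'+1+1) * ((n'+1+1) * ((n'+1+2) * (L+1) ^ n')) := by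
  classical
  set a : Fin m → Fin (n'+1) → ℝ := fun i j => (A i j : ℝ) with ha
  obtain ⟨β, hβ, hgen⟩ := generic_eps a (fun i => (b i : ℝ))
  have hD0 : 0 ≤ D := by rw [hD]; positivity
  obtain ⟨q, hq⟩ : ∃ q : Finset (Fin m) → Fin (n'+1) → ℝ, ∀ I : Finset (Fin m),
      (∃ x, (∀ i, a i ⬝ᵥ x ≤ β i) ∧ ∀ i ∈ I, a i ⬝ᵥ x = β i) →
      (∀ i, a i ⬝ᵥ q I ≤ β i) ∧ ∀ i ∈ I, a i ⬝ᵥ q I = β i := by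
    have : ∀ I : Finset (Fin m), ∃ y, (∃ x, (∀ i, a i ⬝ᵥ x ≤ β i) ∧ ∀ i ∈ I, a i ⬝ᵥ x = β i) →
      (∀ i, a i ⬝ᵥ y ≤ β i) ∧ ∀ i ∈ I, a i ⬝ᵥ y = β i := by
      intro I
      by_cases h : ∃ x, (∀ i, a i ⬝ᵥ x ≤ β i) ∧ ∀ i ∈ I, a i ⬝ᵥ x = β i
      · obtain ⟨x, hx⟩ := h
        exact ⟨x, fun _ => hx⟩
      · exact ⟨0, fun h' => absurd h' h⟩
    choose q hq using this
    exact ⟨q, hq⟩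
  let 𝓑 : Finset (Finset (Fin m)) := Finset.univ.filter fun B =>
    B.card = n'+1 ∧ LinearIndepOn ℝ a (B : Set (Fin m)) ∧
        ∃ v, (∀ i, a i ⬝ᵥ v ≤ β i) ∧ ∀ i ∈ B, a i ⬝ᵥ v = β i
  have h𝓑 := card_bases hm a β hgen 𝓑 (fun B hB => (Finset.mem_filter.1 hB).2)
  -- radii
  have hGex : ∀ (g : Fin (n'+1+1) → Finset (Fin m)) (k0 k : Fin (n'+1+1)), ∃ G : ℝ, 0 ≤ G ∧
      (∀ i, β i - a i ⬝ᵥ q (g k0) ≤ 3 * ((n'+1:ℕ) * (α * D)) → max 0 (β i - a i ⬝ᵥ q (g k)) ≤ G) ∧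
      ∀ w C : ℝ, 0 ≤ C → (∀ i, β i - a i ⬝ᵥ q (g k0) ≤ 3 * ((n'+1:ℕ) * (α * D)) →
        w * max 0 (β i - a i ⬝ᵥ q (g k)) ≤ C) → w * G ≤ C := by
    intro g k0 k
    exact exists_G {i | β i - a i ⬝ᵥ q (g k0) ≤ 3 * ((n'+1:ℕ) * (α * D))}
      (fun i => max 0 (β i - a i ⬝ᵥ q (g k))) (fun i => le_max_left _ _)
  choose G hG0 hG1 hG2 using hGex
  -- data
  have hdata : ∀ x : vertN m (n'+1) A b, ∃ (B : Finset (Fin m)) (g : Fin (n'+1+1) → Finset (Fin m))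
      (w : Fin (n'+1+1) → ℝ) (k0 : Fin (n'+1+1)), B ∈ 𝓑 ∧ (∀ k, g k ⊆ B) ∧
      (∀ k i, a i ⬝ᵥ q (g k) ≤ β i) ∧ (∀ k, 0 ≤ w k) ∧ (∀ k, w k ≤ 1) ∧
      (∀ i, β i - a i ⬝ᵥ x.1 = ∑ k, w k * (β i - a i ⬝ᵥ q (g k))) ∧
      1 ≤ ((n'+1:ℕ) + 1) * w k0 := by
    rintro ⟨x, hx⟩
    have hxI : x ∈ intPoints m (n'+1) A b := extremePoints_convexHull_subset hx
    obtain ⟨B, hB1, hB2, -, hB3, g, w, hg, hgP, hw, hw1, hxw⟩ := cover a β hrec q hq (n'+1) ∅ x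
      (by simp) (by simp)
      (fun i => (show a i ⬝ᵥ x ≤ b i from hxI.2 i).trans (hβ i).1.le) (by simp)
    obtain ⟨k0, hk0⟩ : ∃ k0, 1 ≤ (((n'+1:ℕ):ℝ) + 1) * w k0 := by
      by_contra hcon
      push Not at hcon
      have h1 : ∑ k, (((n'+1:ℕ):ℝ) + 1) * w k < ∑ k : Fin (n'+1+1), (1:ℝ) :=
        Finset.sum_lt_sum_of_nonempty Finset.univ_nonempty (fun k _ => hcon k)
      rw [← Finset.mul_sum, hw1] at h1
      simp at h1
    refine ⟨B, g, w, k0, by simp [𝓑, hB1, hB2]; exact hB3, hg, hgP, hw, ?_, ?_, hk0⟩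
    · intro k
      rw [← hw1]
      exact Finset.single_le_sum (fun k _ => hw k) (Finset.mem_univ k)
    · intro i
      simp only [mul_sub, Finset.sum_sub_distrib, ← Finset.sum_mul, hw1, one_mul]
      congr 1
      conv_lhs => rw [hxw]
      rw [dotProduct_sum]
      simp [dotProduct_smul]
  choose B g w k0 hB hg hgP hw hwle hs hk0 using hdata
  have hdist : ∀ (x : vertN m (n'+1) A b) j, |q (g x (k0 x)) j - x.1 j| ≤ D := by
    intro x j
    rw [hD]
    exact dist_bound (by omega) A b α hα hA β hβ (fun k => q (g x k)) (hgP x) x.1 x.2 (w x) (hw x) (hs x)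
      (k0 x) (hk0 x) j
  have hwG : ∀ (x : vertN m (n'+1) A b) k, w x k * G (g x) (k0 x) k ≤ 4 * ((n'+1:ℕ) * (α * D)) := by
    intro x k
    apply hG2
    · positivity
    intro i hi
    rw [max_eq_right (by linarith [hgP x k i])]
    have h1 : w x k * (β i - a i ⬝ᵥ q (g x k)) ≤ β i - a i ⬝ᵥ x.1 := by
      rw [hs x i]
      exact Finset.single_le_sum (f := fun k => w x k * (β i - a i ⬝ᵥ q (g x k)))
        (fun k _ => mul_nonneg (hw x k) (by linarith [hgP x k i])) (Finset.mem_univ k)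
    have h2 : |a i ⬝ᵥ (q (g x (k0 x)) - x.1)| ≤ (n'+1:ℕ) * (α * D) := by
      refine (Finset.abs_sum_le_sum_abs _ _).trans ?_
      refine (Finset.sum_le_card_nsmul _ _ (α * D) ?_).trans (by simp)
      intro j _
      rw [abs_mul]
      exact mul_le_mul (hA i j) (hdist x j) (abs_nonneg _) (by linarith)
    have h3 := abs_le.1 h2
    rw [dotProduct_sub] at h3
    linarith
  have hcls : ∀ (x : vertN m (n'+1) A b) k,
      Nat.log 2 ⌊4 * (((n'+1:ℕ):ℝ)+1) * (w x k * G (g x) (k0 x) k)⌋₊ < L + 1 := by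
    intro x k
    rw [Nat.lt_succ_iff, hL]
    apply Nat.log_mono_right
    apply Nat.floor_mono
    exact mul_le_mul_of_nonneg_left (hwG x k) (by positivity)
  have hfl : ∀ (x : vertN m (n'+1) A b), ⌊(((n'+1:ℕ):ℝ)+1) * w x (k0 x)⌋₊ < n'+1+2 := by
    intro x
    have h1 : (((n'+1:ℕ):ℝ)+1) * w x (k0 x) ≤ ((n'+1+1 : ℕ):ℝ) := by
      rw [Nat.cast_add_one (n'+1)]
      exact mul_le_of_le_one_right (by positivity) (hwle x _)
    have := Nat.floor_le_of_le h1
    omega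
  let Tg : Finset ((Σ _ : Finset (Fin m), (Fin (n'+1+1) → Finset (Fin m))) ×
      (Fin (n'+1+1) × (Fin (n'+1+2) × (Fin n' → Fin (L+1))))) :=
    (𝓑.sigma fun B => Fintype.piFinset fun _ => B.powerset) ×ˢ Finset.univ
  let Φ : vertN m (n'+1) A b → Tg := fun x =>
    ⟨(⟨B x, g x⟩, (k0 x, (⟨_, hfl x⟩, fun j => ⟨_, hcls x ((k0 x).succAbove j.succ)⟩))), by
      simp only [Tg, Finset.mem_product, Finset.mem_sigma, Fintype.mem_piFinset, Finset.mem_powerset,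
        Finset.mem_univ, and_true]
      exact ⟨hB x, hg x⟩⟩
  have hhalf : ∀ x y : vertN m (n'+1) A b, Φ x = Φ y →
      w x ((k0 x).succAbove 0) ≤ w y ((k0 x).succAbove 0) → x = y := by
    intro x y hxy hle
    have h1 := congrArg Subtype.val hxy
    simp only [Φ, Prod.mk.injEq, Sigma.mk.injEq, Fin.mk.injEq, heq_eq_eq] at h1
    obtain ⟨⟨-, hgg⟩, hkk, hff, hcc⟩ := h1
    have hk0y := hk0 y
    have hdy := hdist y
    have hsy := hs y
    rw [← hkk] at hk0y hdy hff
    rw [← hgg] at hdy hsy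
    apply Subtype.ext
    refine same_class A b α hα hA β hβ (fun k => q (g x k)) (hgP x) D (k0 x) (G (g x) (k0 x))
      (fun k i hi => (le_max_right _ _).trans (hG1 (g x) (k0 x) k i hi)) (hG0 _ _)
      x.1 x.2 (w x) (hw x) (hs x) (hdist x) y.1 y.2 (w y) (hw y) hsy hdy ?_ hle ?_
    · have := floor_class _ _ hk0y hff
      have h2 : 0 ≤ (((n'+1:ℕ):ℝ)+1) * (2 * w y (k0 x) - w x (k0 x)) := by linarith
      exact nonneg_of_mul_nonneg_right h2 (by positivity)
    · intro j
      have := congrFun hcc j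
      simp only [Fin.mk.injEq] at this
      rw [← hkk, ← hgg] at this
      exact this
  have hinj : Function.Injective Φ := by
    intro x y hxy
    have hkk : k0 x = k0 y := by
      have h1 := congrArg Subtype.val hxy
      simp only [Φ, Prod.mk.injEq] at h1
      exact h1.2.1
    rcases le_total (w x ((k0 x).succAbove 0)) (w y ((k0 x).succAbove 0)) with h | h
    · exact hhalf x y hxy h
    · exact (hhalf y x hxy.symm (by rwa [← hkk])).symm
  have hfin : (vertN m (n'+1) A b).Finite :=
    Set.finite_coe_iff.1 (Finite.of_injective Φ hinj)
  refine ⟨hfin, ?_⟩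
  have hc : (vertN m (n'+1) A b).ncard ≤ Tg.card := by
    have := Nat.card_le_card_of_injective Φ hinj
    rw [Nat.card_coe_set_eq] at this
    simpa using this
  refine hc.trans ?_
  have hTg : Tg.card = 𝓑.card * (2 ^ (n'+1)) ^ (n'+1+1) * ((n'+1+1) * ((n'+1+2) * (L+1) ^ n')) := by
    rw [Finset.card_product, Finset.card_sigma]
    rw [Finset.sum_congr rfl (g := fun _ => (2 ^ (n'+1)) ^ (n'+1+1)) (by
      intro B hB
      have : B.card = n'+1 := (Finset.mem_filter.1 hB).2.1
      simp [Fintype.card_piFinset, this])]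
    simp
  rw [hTg]
  gcongr

theorem card_vertN_le_of_rank (n : ℕ) :
    ∃ c : ℝ, ∀ (m : ℕ) (A : Matrix (Fin m) (Fin n) ℤ) (b : Fin m → ℤ),
      A.rank = n →
      ({x : Fin n → ℝ | ∀ i, ∑ j, (A i j : ℝ) * x j ≤ (b i : ℝ)}).Nonempty →
      Bornology.IsBounded {x : Fin n → ℝ | ∀ i, ∑ j, (A i j : ℝ) * x j ≤ (b i : ℝ)} →
      (vertN m n A b).Finite ∧
        ((vertN m n A b).ncard : ℝ) ≤
          c * (m : ℝ) ^ (n / 2) *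
            Real.logb 2
              (1 + ((Finset.univ.sup fun p : Fin m × Fin n => (A p.1 p.2).natAbs : ℕ) : ℝ)) ^
              (n - 1) := by
  rcases n with _ | n'
  · refine ⟨1, fun m A b _ _ _ => ⟨Set.toFinite _, ?_⟩⟩
    have : (vertN m 0 A b).ncard ≤ 1 := Set.ncard_le_one_of_subsingleton _
    simpa using this
  obtain ⟨K, hK0, hK⟩ := log_bound (n'+1) (by omega)
  refine ⟨(2 * (((n'+1)/2+1 : ℕ) : ℝ)) * (2 ^ (n'+1)) ^ (n'+1+1) * (((n'+1+1 : ℕ) : ℝ) * ((n'+1+2 : ℕ) : ℝ)) * K ^ n', ?_⟩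
  intro m A b _ hne hbd
  have hrec := no_recession (fun i j => (A i j : ℝ)) (fun i => (b i : ℝ)) hne hbd
  obtain ⟨i0, hi0⟩ := hrec (Pi.single 0 1) (by simp)
  have hi0' : A i0 0 ≠ 0 := by
    intro h; simp [h] at hi0
  have hm : 1 ≤ m := by have := i0.2; omega
  set s : ℕ := Finset.univ.sup fun p : Fin m × Fin (n'+1) => (A p.1 p.2).natAbs with hsdef
  have hAs : ∀ i j, (A i j).natAbs ≤ s := fun i j =>
    Finset.le_sup (f := fun p : Fin m × Fin (n'+1) => (A p.1 p.2).natAbs) (Finset.mem_univ (i, j))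
  have hα : (1:ℝ) ≤ s := by
    have h1 := hAs i0 0
    have h2 := Int.natAbs_pos.2 hi0'
    exact_mod_cast (by omega : 1 ≤ s)
  have hA : ∀ i j, |(A i j : ℝ)| ≤ s := by
    intro i j
    have := hAs i j
    rw [← Int.cast_abs, ← Int.natCast_natAbs]
    exact_mod_cast this
  obtain ⟨hfin, hcard⟩ := main_count hm A b hrec s hα hA _ rfl _ rfl
  refine ⟨hfin, ?_⟩
  have hK' := hK s hα
  set L := Nat.log 2 ⌊4 * (((n'+1:ℕ):ℝ)+1) * (4 * ((n'+1:ℕ) * ((s:ℝ) * ((n'+1:ℕ) * (((n'+1).factorial * (s:ℝ) ^ (n'+1)) * (((n'+1:ℕ)+1) * ((n'+1:ℕ) * ((s:ℝ) * ((n'+1:ℕ) * (s:ℝ)) ^ (n'+1)) + 1)))))))⌋₊ with hL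
  have hcR : ((vertN m (n'+1) A b).ncard : ℝ) ≤ ((2 * (((n'+1)/2+1) * m ^ ((n'+1)/2))) * (2 ^ (n'+1)) ^ (n'+1+1) * ((n'+1+1) * ((n'+1+2) * (L+1) ^ n')) : ℕ) := by
    exact_mod_cast hcard
  refine hcR.trans ?_
  have hpow : ((L:ℝ)+1) ^ n' ≤ (K * Real.logb 2 (1 + s)) ^ n' := by gcongr
  rw [mul_pow] at hpow
  rw [Nat.add_sub_cancel]
  calc (((2 * (((n'+1)/2+1) * m ^ ((n'+1)/2))) * (2 ^ (n'+1)) ^ (n'+1+1) * ((n'+1+1) * ((n'+1+2) * (L+1) ^ n')) : ℕ) : ℝ)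
      = (2 * (((n'+1)/2+1 : ℕ) : ℝ)) * (2 ^ (n'+1)) ^ (n'+1+1) * (((n'+1+1 : ℕ) : ℝ) * ((n'+1+2 : ℕ) : ℝ)) * (m:ℝ) ^ ((n'+1)/2) * ((L:ℝ)+1) ^ n' := by
        rw [Nat.cast_mul, Nat.cast_mul, Nat.cast_mul, Nat.cast_mul, Nat.cast_mul, Nat.cast_mul]
        simp only [Nat.cast_pow, Nat.cast_ofNat, Nat.cast_add_one L]
        ring
    _ ≤ (2 * (((n'+1)/2+1 : ℕ) : ℝ)) * (2 ^ (n'+1)) ^ (n'+1+1) * (((n'+1+1 : ℕ) : ℝ) * ((n'+1+2 : ℕ) : ℝ)) * (m:ℝ) ^ ((n'+1)/2) * (K ^ n' * Real.logb 2 (1 + s) ^ n') := by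
        gcongr
    _ = _ := by ring
end

section
/- Let a₀, a₁, …, aₙ be natural numbers and a = (a₁,…,aₙ). For i = 1,…,n let Mᵢ be the set of solutions x ∈ ℤⁿ of Σ_{j=1}^{n} aⱼxⱼ ≤ a₀ with xⱼ ≥ 0 for all j ≠ i, and let Nᵢ be the vertex set of Conv(Mᵢ). Then |Nᵢ| ≤ C(⌊log₂ aᵢ⌋ + n − 1, n − 1), where C(·,·) is the binomial coefficient. -/
/-- `Mᵢ`: the set of integer solutions of `∑ aⱼ xⱼ ≤ a₀` with `xⱼ ≥ 0` for all `j ≠ i`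
(the sign of `xᵢ` unconstrained), viewed inside `ℝⁿ`. -/
def relaxKnapPoints (n : ℕ) (a : Fin n → ℕ) (a₀ : ℕ) (i : Fin n) : Set (Fin n → ℝ) :=
  {x | (∀ j, ∃ z : ℤ, x j = (z : ℝ)) ∧ (∀ j, j ≠ i → 0 ≤ x j) ∧
       ∑ j, (a j : ℝ) * x j ≤ (a₀ : ℝ)}

/-- `Nᵢ`: the set of vertices (extreme points) of `Conv Mᵢ`. -/
def relaxKnapVert (n : ℕ) (a : Fin n → ℕ) (a₀ : ℕ) (i : Fin n) : Set (Fin n → ℝ) :=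
  Set.extremePoints ℝ (convexHull ℝ (relaxKnapPoints n a a₀ i))

/-- integer vertex predicate -/
def IntV (n : ℕ) (a : Fin n → ℕ) (a₀ : ℕ) (i : Fin n) (z : Fin n → ℤ) : Prop :=
  (∀ j, j ≠ i → 0 ≤ z j) ∧ (∑ j, (a j : ℤ) * z j ≤ a₀) ∧
  ∀ d : Fin n → ℤ, (∀ j, j ≠ i → 0 ≤ z j + d j) → (∀ j, j ≠ i → 0 ≤ z j - d j) →
    (∑ j, (a j : ℤ) * (z j + d j) ≤ a₀) → (∑ j, (a j : ℤ) * (z j - d j) ≤ a₀) → d = 0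

theorem mem_points_of_int (n : ℕ) (a : Fin n → ℕ) (a₀ : ℕ) (i : Fin n) (z : Fin n → ℤ)
    (h1 : ∀ j, j ≠ i → 0 ≤ z j) (h2 : ∑ j, (a j : ℤ) * z j ≤ a₀) :
    (fun j => (z j : ℝ)) ∈ relaxKnapPoints n a a₀ i := by
  refine ⟨fun j => ⟨z j, rfl⟩, fun j hj => by beta_reduce; exact_mod_cast h1 j hj, ?_⟩
  beta_reduce
  exact_mod_cast h2

theorem vert_int (n : ℕ) (a : Fin n → ℕ) (a₀ : ℕ) (i : Fin n) (v : Fin n → ℝ)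
    (hv : v ∈ relaxKnapVert n a a₀ i) :
    ∃ z : Fin n → ℤ, v = (fun j => (z j : ℝ)) ∧ IntV n a a₀ i z := by
  have hm : v ∈ relaxKnapPoints n a a₀ i := extremePoints_convexHull_subset hv
  obtain ⟨hz, hp, hs⟩ := hm
  choose z hz using hz
  have hvz : v = (fun j => (z j : ℝ)) := funext hz
  subst hvz
  beta_reduce at hp hs
  refine ⟨z, rfl, fun j hj => by exact_mod_cast hp j hj, by exact_mod_cast hs, ?_⟩
  intro d h1 h2 h3 h4
  have m1 := mem_points_of_int n a a₀ i (fun j => z j + d j) h1 h3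
  have m2 := mem_points_of_int n a a₀ i (fun j => z j - d j) h2 h4
  have := (mem_extremePoints.1 hv).2 _ (subset_convexHull ℝ _ m1) _ (subset_convexHull ℝ _ m2)
    ⟨1/2, 1/2, by norm_num, by norm_num, by norm_num, by
      ext j; simp; ring⟩
  funext j
  have := congrFun this.1 j
  simpa using this

theorem prod_le (n : ℕ) (a : Fin n → ℕ) (a₀ : ℕ) (i : Fin n) (ha : 0 < a i) (z : Fin n → ℤ)
    (h : IntV n a a₀ i z) : ∏ j ∈ Finset.univ.erase i, ((z j).toNat + 1) ≤ a i := by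
  obtain ⟨h0, hs, hd⟩ := h
  by_contra! hc
  have hai : (0 : ℤ) < a i := by exact_mod_cast ha
  let S : Finset (Fin n → ℤ) :=
    Fintype.piFinset (fun j => if j = i then {0} else Finset.Icc 0 (z j))
  have hcard : S.card = ∏ j ∈ Finset.univ.erase i, ((z j).toNat + 1) := by
    rw [Fintype.card_piFinset, ← Finset.mul_prod_erase _ _ (Finset.mem_univ i)]
    simp only [if_true, Finset.card_singleton, one_mul]
    refine Finset.prod_congr rfl fun j hj => ?_
    have hji := Finset.ne_of_mem_erase hj
    have := h0 j hji
    rw [if_neg hji, Int.card_Icc]; omega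
  obtain ⟨w, hw, w', hw', hne, heq⟩ := Finset.exists_ne_map_eq_of_card_lt_of_maps_to
    (s := S) (t := Finset.Ico (0:ℤ) (a i)) (f := fun w => (∑ j, (a j : ℤ) * w j) % (a i))
    (by rw [hcard]; simpa using hc)
    (by
      intro w _
      simp only [Finset.coe_Ico, Set.mem_Ico]
      exact ⟨Int.emod_nonneg _ hai.ne', Int.emod_lt_of_pos _ hai⟩)
  obtain ⟨q, hq⟩ := Int.ModEq.dvd (show Int.ModEq _ _ _ from heq)
  have hwi : ∀ w ∈ S, w i = 0 := by
    intro w hw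
    have := Fintype.mem_piFinset.1 hw i
    simpa using this
  have hwj : ∀ w ∈ S, ∀ j, j ≠ i → 0 ≤ w j ∧ w j ≤ z j := by
    intro w hw j hj
    have := Fintype.mem_piFinset.1 hw j
    simpa [hj] using this
  let d : Fin n → ℤ := fun j => if j = i then -q else w' j - w j
  have hsum : ∑ j, (a j : ℤ) * d j = 0 := by
    have e1 : ∑ j, (a j : ℤ) * d j = ∑ j, ((a j : ℤ) * w' j - (a j : ℤ) * w j
        - if j = i then (a i : ℤ) * q else 0) := by
      refine Finset.sum_congr rfl fun j _ => ?_
      by_cases hj : j = i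
      · subst hj
        simp [d, hwi w hw, hwi w' hw']
      · simp [d, hj]; ring
    rw [e1, Finset.sum_sub_distrib, Finset.sum_sub_distrib, hq]
    simp
  have hd0 : d = 0 := by
    apply hd d
    · intro j hj
      have := hwj w hw j hj
      have := hwj w' hw' j hj
      simp only [d, if_neg hj]; omega
    · intro j hj
      have := hwj w hw j hj
      have := hwj w' hw' j hj
      simp only [d, if_neg hj]; omega
    · simp only [mul_add, Finset.sum_add_distrib, hsum]; simpa using hs
    · simp only [mul_sub, Finset.sum_sub_distrib, hsum]; simpa using hs
  apply hne
  funext j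
  by_cases hj : j = i
  · subst hj; rw [hwi w hw, hwi w' hw']
  · have := congrFun hd0 j
    simp only [d, if_neg hj, Pi.zero_apply] at this
    omega

theorem log_box (y y' : ℕ) (h : Nat.log 2 (y + 1) = Nat.log 2 (y' + 1)) : y' ≤ 2 * y := by
  have h1 := Nat.pow_log_le_self 2 (x := y + 1) (by omega)
  have h2 := Nat.lt_pow_succ_log_self (b := 2) (by norm_num) (y' + 1)
  rw [← h, Nat.pow_succ] at h2
  omega

theorem inj_aux (n : ℕ) (a : Fin n → ℕ) (a₀ : ℕ) (i : Fin n) (z z' : Fin n → ℤ)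
    (h : IntV n a a₀ i z) (h' : IntV n a a₀ i z')
    (hl : ∀ j, j ≠ i → Nat.log 2 ((z j).toNat + 1) = Nat.log 2 ((z' j).toNat + 1))
    (hle : ∑ j, (a j : ℤ) * z j ≤ ∑ j, (a j : ℤ) * z' j) : z = z' := by
  have hd := h.2.2 (fun j => z' j - z j)
    (by intro j hj; have := h'.1 j hj; simpa using this)
    (by
      intro j hj
      have h1 := h'.1 j hj
      have h2 := h.1 j hj
      have := log_box _ _ (hl j hj)
      show 0 ≤ z j - (z' j - z j)
      omega)
    (by simpa using h'.2.1)
    (by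
      have := h.2.1
      simp only [mul_sub, Finset.sum_sub_distrib]
      linarith)
  funext j
  have := congrFun hd j
  simp only [Pi.zero_apply] at this
  omega

theorem sum_log_le (n : ℕ) (a : Fin n → ℕ) (a₀ : ℕ) (i : Fin n) (ha : 0 < a i) (z : Fin n → ℤ)
    (h : IntV n a a₀ i z) :
    ∑ j ∈ Finset.univ.erase i, Nat.log 2 ((z j).toNat + 1) ≤ Nat.log 2 (a i) := by
  apply Nat.le_log_of_pow_le (by norm_num)
  refine le_trans ?_ (prod_le n a a₀ i ha z h)
  rw [← Finset.prod_pow_eq_pow_sum]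
  exact Finset.prod_le_prod' fun j _ => Nat.pow_log_le_self 2 (by omega)

/-- `|Nᵢ| ≤ C(⌊log₂ aᵢ⌋ + n − 1, n − 1)`. -/
theorem card_relaxKnapVert_le (n : ℕ) (a : Fin n → ℕ) (a₀ : ℕ)
    (ha : ∀ j, 0 < a j) (ha₀ : 0 < a₀) (i : Fin n) :
    (relaxKnapVert n a a₀ i).Finite ∧
      (relaxKnapVert n a a₀ i).ncard ≤ Nat.choose (Nat.log 2 (a i) + n - 1) (n - 1) := by
  classical
  let F : (Fin n → ℝ) → (Fin n →₀ ℕ) := fun v => Finsupp.equivFunOnFinite.symm (fun j =>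
    if j = i then Nat.log 2 (a i) - ∑ j ∈ Finset.univ.erase i, Nat.log 2 (⌊v j⌋.toNat + 1)
    else Nat.log 2 (⌊v j⌋.toNat + 1))
  let T : Finset (Fin n →₀ ℕ) := Finset.finsuppAntidiag Finset.univ (Nat.log 2 (a i))
  have hmaps : ∀ v ∈ relaxKnapVert n a a₀ i, F v ∈ (T : Set (Fin n →₀ ℕ)) := by
    intro v hv
    obtain ⟨z, rfl, hz⟩ := vert_int n a a₀ i v hv
    have hle := sum_log_le n a a₀ i (ha i) z hz
    refine Finset.mem_coe.2 (Finset.mem_finsuppAntidiag.2 ⟨?_, Finset.subset_univ _⟩)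
    rw [← Finset.add_sum_erase _ _ (Finset.mem_univ i)]
    have e : ∑ j ∈ Finset.univ.erase i, (F fun j => (z j : ℝ)) j
        = ∑ j ∈ Finset.univ.erase i, Nat.log 2 ((z j).toNat + 1) := by
      refine Finset.sum_congr rfl fun j hj => ?_
      simp [F, Finset.ne_of_mem_erase hj]
    rw [e]
    have e2 : (F fun j => (z j : ℝ)) i = Nat.log 2 (a i)
        - ∑ j ∈ Finset.univ.erase i, Nat.log 2 ((z j).toNat + 1) := by
      simp [F]
    rw [e2]; omega
  have hinj : Set.InjOn F (relaxKnapVert n a a₀ i) := by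
    intro v hv v' hv' hF
    obtain ⟨z, rfl, hz⟩ := vert_int n a a₀ i v hv
    obtain ⟨z', rfl, hz'⟩ := vert_int n a a₀ i v' hv'
    have hl : ∀ j, j ≠ i → Nat.log 2 ((z j).toNat + 1) = Nat.log 2 ((z' j).toNat + 1) := by
      intro j hj
      have := DFunLike.congr_fun hF j
      simpa [F, hj] using this
    have : z = z' := by
      rcases le_total (∑ j, (a j : ℤ) * z j) (∑ j, (a j : ℤ) * z' j) with h | h
      · exact inj_aux n a a₀ i z z' hz hz' hl h
      · exact (inj_aux n a a₀ i z' z hz' hz (fun j hj => (hl j hj).symm) h).symm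
    rw [this]
  refine ⟨Set.Finite.of_injOn hmaps hinj T.finite_toSet, ?_⟩
  have hc := Set.ncard_le_ncard_of_injOn F hmaps hinj T.finite_toSet
  rw [Set.ncard_coe_finset, Finset.card_finsuppAntidiag_nat_eq_choose, Finset.card_univ,
    Fintype.card_fin] at hc
  have hn : 0 < n := i.pos
  have : Nat.log 2 (a i) + n - 1 = (n - 1) + Nat.log 2 (a i) := by omega
  have h2 : n + Nat.log 2 (a i) - 1 = (n - 1) + Nat.log 2 (a i) := by omega
  rw [this, Nat.choose_symm_add, ← h2]
  exact hc
end

section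
/- Let a₀, a₁, …, aₙ be natural numbers, a = (a₁,…,aₙ), and α₁ = max{a₁,…,aₙ}. For i = 1,…,n let Mᵢ be the set of x ∈ ℤⁿ with Σ_{j=1}^{n} aⱼxⱼ ≤ a₀ and xⱼ ≥ 0 for all j ≠ i, let Nᵢ be the vertex set of Conv(Mᵢ), and set N₀ = {0}. If a₀ ≥ α₁(α₁ − 1), then 𝒩(a,a₀) = ∪_{i=0}^{n} Nᵢ, and consequently |𝒩(a,a₀)| ≤ 1 + Σ_{i=1}^{n} C(⌊log₂ aᵢ⌋ + n − 1, n − 1) ≤ 1 + n(⌊log₂ α₁⌋ + 1)^{n−1}. -/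
/-- `ℳ(a, a₀)`: the set of nonnegative integer solutions of `∑ aⱼ xⱼ ≤ a₀`,
viewed inside `ℝⁿ`. -/
def knapPoints (n : ℕ) (a : Fin n → ℕ) (a₀ : ℕ) : Set (Fin n → ℝ) :=
  {x | (∀ j, ∃ z : ℤ, x j = (z : ℝ)) ∧ (∀ j, 0 ≤ x j) ∧
       ∑ j, (a j : ℝ) * x j ≤ (a₀ : ℝ)}

/-- `𝒩(a, a₀)`: the set of vertices (extreme points) of the knapsack polytope,
the convex hull of `ℳ(a, a₀)`. -/
def knapVert (n : ℕ) (a : Fin n → ℕ) (a₀ : ℕ) : Set (Fin n → ℝ) :=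
  Set.extremePoints ℝ (convexHull ℝ (knapPoints n a a₀))

/-- point with `j`-coordinates `p j`, shifted by `t` along the `i`-th axis -/
def kpt {n : ℕ} (i : Fin n) (p : Fin n → ℕ) (t : ℤ) : Fin n → ℝ :=
  fun j => (p j : ℝ) + (if j = i then (t : ℝ) else 0)

lemma kpt_lin {n : ℕ} (i : Fin n) (p : Fin n → ℕ) (t : ℤ) (c : Fin n → ℝ) :
    ∑ j, c j * kpt i p t j = ∑ j, c j * (p j : ℝ) + c i * t := by
  simp [kpt, mul_add, Finset.sum_add_distrib]

lemma kpt_mem {n : ℕ} {a : Fin n → ℕ} {a₀ : ℕ} (i : Fin n) (p : Fin n → ℕ) (t : ℤ)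
    (h : ∑ j, (a j : ℤ) * p j + a i * t ≤ a₀) : kpt i p t ∈ relaxKnapPoints n a a₀ i := by
  refine ⟨fun j => ⟨p j + (if j = i then t else 0), ?_⟩, fun j hj => ?_, ?_⟩
  · simp only [kpt]; split_ifs <;> simp
  · simp [kpt, hj]
  · rw [kpt_lin i p t (fun j => (a j : ℝ))]
    exact_mod_cast h

lemma kpt_mem_iff {n : ℕ} {a : Fin n → ℕ} {a₀ : ℕ} (i : Fin n) (p : Fin n → ℕ) (t : ℤ) :
    kpt i p t ∈ relaxKnapPoints n a a₀ i ↔ ∑ j, (a j : ℤ) * p j + a i * t ≤ a₀ := by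
  refine ⟨fun h => ?_, kpt_mem i p t⟩
  have := h.2.2
  rw [kpt_lin i p t (fun j => (a j : ℝ))] at this
  exact_mod_cast this

lemma exists_kpt {n : ℕ} {a : Fin n → ℕ} {a₀ : ℕ} {i : Fin n} {x : Fin n → ℝ}
    (hx : x ∈ relaxKnapPoints n a a₀ i) : ∃ p t, p i = 0 ∧ x = kpt i p t := by
  obtain ⟨h1, h2, -⟩ := hx
  choose z hz using h1
  refine ⟨fun j => if j = i then 0 else (z j).toNat, z i, by simp, ?_⟩
  ext j
  by_cases hj : j = i
  · subst hj; simp [kpt, hz]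
  · have h0 : 0 ≤ z j := by have := h2 j hj; rw [hz] at this; exact_mod_cast this
    simp only [kpt, hj, if_false, add_zero, hz]
    exact_mod_cast (Int.toNat_of_nonneg h0).symm

lemma not_mid {E : Type*} [AddCommGroup E] [Module ℝ E] {S : Set E} {x y z : E}
    (hx : x ∈ Set.extremePoints ℝ (convexHull ℝ S)) (hy : y ∈ S) (hz : z ∈ S)
    (h : y + z = (2 : ℝ) • x) : y = x := by
  refine ((mem_extremePoints.1 hx).2 y (subset_convexHull ℝ S hy) z (subset_convexHull ℝ S hz) ?_).1
  refine ⟨1/2, 1/2, by norm_num, by norm_num, by norm_num, ?_⟩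
  rw [← smul_add, h, smul_smul]; norm_num

lemma kpt_ext {n : ℕ} {i : Fin n} {p q : Fin n → ℕ} {t s : ℤ} (h : kpt i p t = kpt i q s) :
    ∀ j, j ≠ i → p j = q j := by
  intro j hj
  have := congrFun h j
  simpa [kpt, hj] using this

lemma box_bound {n : ℕ} {a : Fin n → ℕ} {a₀ : ℕ} {i : Fin n} (ha : 0 < a i) {p : Fin n → ℕ} {t : ℤ}
    (hp : p i = 0) (hx : kpt i p t ∈ relaxKnapVert n a a₀ i) : ∏ j, (p j + 1) ≤ a i := by
  by_contra! hlt
  have hM := (kpt_mem_iff i p t).1 (extremePoints_convexHull_subset hx)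
  obtain ⟨q, hq, r, hr, hne, heq⟩ := Finset.exists_ne_map_eq_of_card_lt_of_maps_to
    (s := Finset.Icc (0 : Fin n → ℕ) p) (t := Finset.range (a i))
    (f := fun q => (∑ j, a j * q j) % a i) (by simpa [Pi.card_Icc] using hlt)
    (fun q _ => by simpa using Nat.mod_lt _ ha)
  have hq' := (Finset.mem_Icc.1 hq).2
  have hr' := (Finset.mem_Icc.1 hr).2
  have hmod : ((∑ j, a j * q j : ℕ) : ℤ) ≡ ((∑ j, a j * r j : ℕ) : ℤ) [ZMOD (a i : ℤ)] :=
    (Int.natCast_modEq_iff).2 heq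
  obtain ⟨s, hs⟩ := hmod.dvd
  push_cast at hs
  have key : ∀ (q r : Fin n → ℕ) (s : ℤ), q ≤ p →
      ∑ j, (a j : ℤ) * r j - ∑ j, (a j : ℤ) * q j = a i * s →
      kpt i (fun j => p j + r j - q j) (t - s) ∈ relaxKnapPoints n a a₀ i := by
    intro q r s hqp h
    apply kpt_mem
    have : ∑ j, (a j : ℤ) * ((p j + r j - q j : ℕ) : ℤ)
        = ∑ j, (a j : ℤ) * p j + (∑ j, (a j : ℤ) * r j - ∑ j, (a j : ℤ) * q j) := by
      rw [← Finset.sum_sub_distrib, ← Finset.sum_add_distrib]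
      refine Finset.sum_congr rfl fun j _ => ?_
      have : q j ≤ p j := hqp j
      rw [Nat.cast_sub (by omega)]; push_cast; ring
    rw [this, h]; linarith
  have h1 := key q r s hq' hs
  have h2 := key r q (-s) hr' (by linarith)
  have := not_mid hx h1 h2 (by
    ext j
    have a1 : q j ≤ p j := hq' j
    have a2 : r j ≤ p j := hr' j
    simp only [kpt, Pi.add_apply, Pi.smul_apply, smul_eq_mul]
    rw [Nat.cast_sub (by omega), Nat.cast_sub (by omega)]
    push_cast
    split_ifs <;> ring)
  apply hne
  ext j
  by_cases hj : j = i
  · subst hj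
    have a1 : q j ≤ p j := hq' j
    have a2 : r j ≤ p j := hr' j
    omega
  · have a1 : q j ≤ p j := hq' j
    have := kpt_ext this j hj
    omega

lemma max_bound {n : ℕ} {a : Fin n → ℕ} {a₀ : ℕ} {i : Fin n} {p : Fin n → ℕ} {t : ℤ}
    (hx : kpt i p t ∈ relaxKnapVert n a a₀ i) : (a₀ : ℤ) < ∑ j, (a j : ℤ) * p j + a i * (t + 1) := by
  by_contra! h
  have hM := (kpt_mem_iff i p t).1 (extremePoints_convexHull_subset hx)
  have h1 := kpt_mem i p (t+1) h
  have h2 : kpt i p (t-1) ∈ relaxKnapPoints n a a₀ i := kpt_mem i p (t-1) (by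
    have : (0:ℤ) ≤ a i := by positivity
    linarith)
  have := congrFun (not_mid hx h1 h2 (by
    ext j
    simp only [kpt, Pi.add_apply, Pi.smul_apply, smul_eq_mul]
    push_cast
    split_ifs <;> ring)) i
  simp [kpt] at this

lemma class_inj {n : ℕ} {a : Fin n → ℕ} {a₀ : ℕ} {i : Fin n} {p q : Fin n → ℕ} {t s : ℤ}
    (hx : kpt i p t ∈ relaxKnapVert n a a₀ i) (hy : kpt i q s ∈ relaxKnapVert n a a₀ i)
    (h : ∀ j, Nat.log 2 (p j + 1) = Nat.log 2 (q j + 1)) : kpt i p t = kpt i q s := by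
  have key : ∀ (p q : Fin n → ℕ) (t s : ℤ), kpt i p t ∈ relaxKnapVert n a a₀ i →
      kpt i q s ∈ relaxKnapVert n a a₀ i → (∀ j, Nat.log 2 (p j + 1) = Nat.log 2 (q j + 1)) →
      (a₀ - (∑ j, (a j : ℤ) * q j + a i * s) ≤ 2 * (a₀ - (∑ j, (a j : ℤ) * p j + a i * t))) →
      kpt i p t = kpt i q s := by
    intro p q t s hx hy h hle
    have hb : ∀ j, q j ≤ 2 * p j := by
      intro j
      have h1 := Nat.pow_log_le_self 2 (x := p j + 1) (by omega)
      have h2 := Nat.lt_pow_succ_log_self (b := 2) (by norm_num) (q j + 1)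
      rw [← h j, pow_succ] at h2
      omega
    have hM := kpt_mem (a := a) (a₀ := a₀) i (fun j => 2 * p j - q j) (2 * t - s) (by
      have : ∑ j, (a j : ℤ) * ((2 * p j - q j : ℕ) : ℤ)
        = 2 * ∑ j, (a j : ℤ) * p j - ∑ j, (a j : ℤ) * q j := by
        rw [Finset.mul_sum, ← Finset.sum_sub_distrib]
        refine Finset.sum_congr rfl fun j _ => ?_
        rw [Nat.cast_sub (hb j)]; push_cast; ring
      rw [this]; linarith)
    refine (not_mid hx (extremePoints_convexHull_subset hy) hM ?_).symm
    ext j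
    simp only [kpt, Pi.add_apply, Pi.smul_apply, smul_eq_mul]
    rw [Nat.cast_sub (hb j)]
    push_cast
    split_ifs <;> ring
  have hM := (kpt_mem_iff i p t).1 (extremePoints_convexHull_subset hx)
  have hM' := (kpt_mem_iff i q s).1 (extremePoints_convexHull_subset hy)
  rcases le_total (a₀ - (∑ j, (a j : ℤ) * q j + a i * s)) (a₀ - (∑ j, (a j : ℤ) * p j + a i * t)) with h' | h'
  · exact key p q t s hx hy h (by linarith)
  · exact (key q p s t hy hx (fun j => (h j).symm) (by linarith)).symm

lemma sum_lt_prod {ι : Type*} (s : Finset ι) (p : ι → ℕ) :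
    ∑ j ∈ s, p j + 1 ≤ ∏ j ∈ s, (p j + 1) := by
  classical
  induction s using Finset.induction_on with
  | empty => simp
  | insert b s hb ih =>
    rw [Finset.sum_insert hb, Finset.prod_insert hb]
    have h1 : 1 ≤ ∏ j ∈ s, (p j + 1) := by omega
    have h2 := Nat.mul_le_mul_left (p b) h1
    rw [add_mul]; omega

lemma sum_small {n : ℕ} {a : Fin n → ℕ} {a₀ : ℕ}
    (hbig : (Finset.univ.sup a) * (Finset.univ.sup a - 1) ≤ a₀) (i : Fin n) (p : Fin n → ℕ)
    (h : ∑ j, p j + 1 ≤ a i) : ∑ j, (a j : ℤ) * p j ≤ a₀ := by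
  have hle : ∀ j, a j ≤ Finset.univ.sup a := fun j => Finset.le_sup (Finset.mem_univ j)
  have : ∑ j, a j * p j ≤ a₀ := calc
    ∑ j, a j * p j ≤ ∑ j, (Finset.univ.sup a) * p j :=
      Finset.sum_le_sum fun j _ => Nat.mul_le_mul_right _ (hle j)
    _ = (Finset.univ.sup a) * ∑ j, p j := by rw [Finset.mul_sum]
    _ ≤ (Finset.univ.sup a) * (Finset.univ.sup a - 1) := by
      apply Nat.mul_le_mul_left
      have := hle i
      omega
    _ ≤ a₀ := hbig
  exact_mod_cast this

lemma relax_sub {n : ℕ} {a : Fin n → ℕ} {a₀ : ℕ} (ha : ∀ j, 0 < a j)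
    (hbig : (Finset.univ.sup a) * (Finset.univ.sup a - 1) ≤ a₀) (i : Fin n) :
    relaxKnapVert n a a₀ i ⊆ knapVert n a a₀ := by
  intro x hx
  have hxM := extremePoints_convexHull_subset hx
  obtain ⟨p, t, hp, rfl⟩ := exists_kpt hxM
  have h1 := (sum_lt_prod _ p).trans (box_bound (ha i) hp hx)
  have h2 := sum_small hbig i p h1
  have h3 := max_bound hx
  have h4 : 0 ≤ t := by
    by_contra! h
    have : (0:ℤ) < a i := by exact_mod_cast ha i
    nlinarith
  have hK : kpt i p t ∈ knapPoints n a a₀ := by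
    refine ⟨hxM.1, fun j => ?_, hxM.2.2⟩
    have : (0:ℝ) ≤ t := by exact_mod_cast h4
    simp only [kpt]; split_ifs <;> positivity
  refine inter_extremePoints_subset_extremePoints_of_subset (convexHull_mono ?_)
    ⟨subset_convexHull ℝ _ hK, hx⟩
  intro y hy
  exact ⟨hy.1, fun j _ => hy.2.1 j, hy.2.2⟩

lemma relax_card {n : ℕ} {a : Fin n → ℕ} {a₀ : ℕ} (ha : ∀ j, 0 < a j) (i : Fin n) :
    (relaxKnapVert n a a₀ i).Finite ∧
    (relaxKnapVert n a a₀ i).ncard ≤ Nat.choose (Nat.log 2 (a i) + n - 1) (n - 1) := by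
  classical
  have hrep : ∀ x : relaxKnapVert n a a₀ i, ∃ p t, p i = 0 ∧ x.1 = kpt i p t :=
    fun x => exists_kpt (extremePoints_convexHull_subset x.2)
  choose p t hp hx using hrep
  have hv : ∀ x, kpt i (p x) (t x) ∈ relaxKnapVert n a a₀ i := fun x => hx x ▸ x.2
  have hs : ∀ x, ∑ j, Nat.log 2 (p x j + 1) ≤ Nat.log 2 (a i) := by
    intro x
    rw [Nat.le_log_iff_pow_le (by norm_num) (ha i).ne', ← Finset.prod_pow_eq_pow_sum]
    refine le_trans (Finset.prod_le_prod' fun j _ => ?_) (box_bound (ha i) (hp x) (hv x))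
    exact Nat.pow_log_le_self 2 (by omega)
  let F : relaxKnapVert n a a₀ i → {P : Fin n → ℕ // ∑ j, P j = Nat.log 2 (a i)} := fun x =>
    ⟨fun j => Nat.log 2 (p x j + 1) +
      (if j = i then Nat.log 2 (a i) - ∑ j, Nat.log 2 (p x j + 1) else 0), by
      have := hs x
      rw [Finset.sum_add_distrib, Finset.sum_ite_eq' ]
      simp only [Finset.mem_univ, if_true]; omega⟩
  have hF : Function.Injective F := by
    intro x y hxy
    apply Subtype.ext
    rw [hx x, hx y]
    refine class_inj (hv x) (hv y) fun j => ?_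
    by_cases hj : j = i
    · subst hj; rw [hp, hp]
    · have := congrFun (congrArg Subtype.val hxy) j
      simpa [F, hj] using this
  let e := (Sym.equivNatSumOfFintype (Fin n) (Nat.log 2 (a i))).symm
  have hG : Function.Injective (e ∘ F) := e.injective.comp hF
  have : Finite (relaxKnapVert n a a₀ i) := Finite.of_injective _ hG
  refine ⟨Set.toFinite _, ?_⟩
  have h := Nat.card_le_card_of_injective _ hG
  rw [Nat.card_eq_fintype_card (α := Sym _ _), Sym.card_sym_eq_multichoose, Nat.multichoose_eq, Fintype.card_fin] at h
  have hn : 0 < n := i.pos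
  rw [Set.ncard_def, Set.encard, ENat.card_eq_coe_natCard] 
  refine h.trans (le_of_eq ?_)
  rw [add_comm n]
  apply Nat.choose_symm_of_eq_add; omega

lemma choose_le_pow' (L m : ℕ) : Nat.choose (L + m) m ≤ (L + 1) ^ m := by
  induction m with
  | zero => simp
  | succ m ih =>
    have h := Nat.add_one_mul_choose_eq (L + m) m
    have : (L + m + 1).choose (m + 1) * (m + 1) ≤ ((L+1)^(m+1)) * (m+1) := by
      rw [← h, pow_succ]
      calc (L + m + 1) * (L+m).choose m ≤ ((L+1) * (m+1)) * (L+1)^m :=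
            Nat.mul_le_mul (by nlinarith) ih
        _ = _ := by ring
    exact Nat.le_of_mul_le_mul_right this (by omega)

lemma exists_chain {n : ℕ} (m : ℕ) : ∀ p : Fin n → ℕ, ∑ j, p j = m →
    ∃ w : ℕ → Fin n → ℕ, (∀ k ≤ m, ∑ j, w k j = k) ∧
      (∀ k l, k ≤ l → ∀ j, w k j ≤ w l j) ∧ ∀ k j, w k j ≤ p j := by
  induction m with
  | zero =>
    intro p hp
    exact ⟨fun _ _ => 0, by intro k hk; simp; omega, by simp, by simp⟩
  | succ m ih =>
    intro p hp
    obtain ⟨b, -, hb⟩ : ∃ b ∈ Finset.univ, p b ≠ 0 := by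
      apply Finset.exists_ne_zero_of_sum_ne_zero; omega
    have hq : ∑ j, (p j - if j = b then 1 else 0) = m := by
      have : ∑ j, (p j - if j = b then 1 else 0) + ∑ j, (if j = b then 1 else 0) = ∑ j, p j := by
        rw [← Finset.sum_add_distrib]
        refine Finset.sum_congr rfl fun j _ => ?_
        split_ifs with h
        · subst h; omega
        · omega
      rw [Finset.sum_ite_eq' ] at this
      simp only [Finset.mem_univ, if_true] at this
      omega
    obtain ⟨w, h1, h2, h3⟩ := ih _ hq
    have h3' : ∀ k j, w k j ≤ p j := fun k j => (h3 k j).trans (Nat.sub_le _ _)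
    refine ⟨fun k => if k ≤ m then w k else p, fun k hk => ?_, fun k l hkl j => ?_, fun k j => ?_⟩
    · dsimp only
      split_ifs with h
      · exact h1 k h
      · omega
    · dsimp only
      split_ifs with h h'
      · exact h2 k l hkl j
      · exact h3' k j
      · omega
      · exact le_rfl
    · dsimp only
      split_ifs
      · exact h3' k j
      · exact le_rfl

lemma exists_rel {n : ℕ} {a : Fin n → ℕ} {i : Fin n} (ha : 0 < a i) (p : Fin n → ℕ)
    (h : a i ≤ ∑ j, p j) : ∃ (u : Fin n → ℕ) (s : ℤ), (∀ j, u j ≤ p j) ∧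
      ∑ j, (a j : ℤ) * u j = a i * s ∧ 0 < ∑ j, u j := by
  obtain ⟨w, h1, h2, h3⟩ := exists_chain _ p rfl
  obtain ⟨k, hk, l, hl, hne, heq⟩ := Finset.exists_ne_map_eq_of_card_lt_of_maps_to
    (s := Finset.range (∑ j, p j + 1)) (t := Finset.range (a i))
    (f := fun k => (∑ j, a j * w k j) % a i) (by simp; omega)
    (fun q _ => by simpa using Nat.mod_lt _ ha)
  wlog hkl : k < l generalizing k l
  · exact this l hl k hk hne.symm heq.symm (by omega)
  have hmod : ((∑ j, a j * w k j : ℕ) : ℤ) ≡ ((∑ j, a j * w l j : ℕ) : ℤ) [ZMOD (a i : ℤ)] :=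
    (Int.natCast_modEq_iff).2 heq
  obtain ⟨s, hs⟩ := hmod.dvd
  push_cast at hs
  have hle := h2 k l hkl.le
  refine ⟨fun j => w l j - w k j, s, fun j => (Nat.sub_le _ _).trans (h3 l j), ?_, ?_⟩
  · rw [← hs, ← Finset.sum_sub_distrib]
    refine Finset.sum_congr rfl fun j _ => ?_
    rw [Nat.cast_sub (hle j)]; ring
  · have e : ∑ j, (w l j - w k j) + ∑ j, w k j = ∑ j, w l j := by
      rw [← Finset.sum_add_distrib]
      refine Finset.sum_congr rfl fun j _ => ?_
      have := hle j; omega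
    simp only [Finset.mem_range] at hk hl
    rw [h1 k (by omega), h1 l (by omega)] at e
    show 0 < ∑ j, (w l j - w k j)
    omega

lemma improve {n : ℕ} {a : Fin n → ℕ} {a₀ : ℕ} (ha : ∀ j, 0 < a j)
    (hbig : (Finset.univ.sup a) * (Finset.univ.sup a - 1) ≤ a₀) (i : Fin n) (c : Fin n → ℝ)
    (hci : 0 < c i) (hc : ∀ j, j ≠ i → c j * a i < c i * a j) (m : ℕ) :
    ∀ (p : Fin n → ℕ) (t : ℤ), ∑ j, p j = m → p i = 0 → ∑ j, (a j : ℤ) * p j + a i * t ≤ a₀ →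
      kpt i p t ∈ knapPoints n a a₀ ∨
        ∃ y ∈ knapPoints n a a₀, ∑ j, c j * kpt i p t j < ∑ j, c j * y j := by
  induction m using Nat.strong_induction_on with
  | _ m ih =>
  intro p t hm hp hfe
  have hnn : ∀ (t : ℤ), 0 ≤ t → ∑ j, (a j : ℤ) * p j + a i * t ≤ a₀ →
      kpt i p t ∈ knapPoints n a a₀ := by
    intro t ht hfe
    have hM := kpt_mem i p t hfe
    refine ⟨hM.1, fun j => ?_, hM.2.2⟩
    have : (0:ℝ) ≤ t := by exact_mod_cast ht
    simp only [kpt]; split_ifs <;> positivity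
  by_cases hsm : a i ≤ ∑ j, p j
  · obtain ⟨u, s, hu, hs, hpos⟩ := exists_rel (ha i) p hsm
    have hui : u i = 0 := by have := hu i; omega
    have hsub : ∑ j, (p j - u j) + ∑ j, u j = ∑ j, p j := by
      rw [← Finset.sum_add_distrib]
      refine Finset.sum_congr rfl fun j _ => ?_
      have := hu j; omega
    have hA : ∑ j, (a j : ℤ) * ((p j - u j : ℕ) : ℤ) = ∑ j, (a j : ℤ) * p j - a i * s := by
      rw [← hs, ← Finset.sum_sub_distrib]
      refine Finset.sum_congr rfl fun j _ => ?_
      rw [Nat.cast_sub (hu j)]; ring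
    have hlt : ∑ j, c j * kpt i p t j < ∑ j, c j * kpt i (fun j => p j - u j) (t + s) j := by
      rw [kpt_lin, kpt_lin]
      have hC : ∑ j, c j * ((p j - u j : ℕ) : ℝ) = ∑ j, c j * (p j : ℝ) - ∑ j, c j * (u j : ℝ) := by
        rw [← Finset.sum_sub_distrib]
        refine Finset.sum_congr rfl fun j _ => ?_
        rw [Nat.cast_sub (hu j)]; ring
      have hsR : ∑ j, (a j : ℝ) * u j = a i * s := by exact_mod_cast hs
      have hai : (0:ℝ) < a i := by exact_mod_cast ha i
      have hlt' : ∑ j, c j * a i * (u j : ℝ) < ∑ j, c i * a j * (u j : ℝ) := by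
        obtain ⟨b, -, hb⟩ : ∃ b ∈ Finset.univ, u b ≠ 0 := by
          apply Finset.exists_ne_zero_of_sum_ne_zero; omega
        have hle : ∀ j, c j * a i ≤ c i * a j := by
          intro j
          by_cases hj : j = i
          · rw [hj]
          · exact (hc j hj).le
        refine Finset.sum_lt_sum (fun j _ => mul_le_mul_of_nonneg_right (hle j) (by positivity))
          ⟨b, Finset.mem_univ _, ?_⟩
        have hbi : b ≠ i := by rintro rfl; exact hb hui
        exact mul_lt_mul_of_pos_right (hc b hbi) (by positivity)
      have e1 : ∑ j, c j * a i * (u j : ℝ) = a i * ∑ j, c j * (u j : ℝ) := by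
        rw [Finset.mul_sum]; exact Finset.sum_congr rfl fun j _ => by ring
      have e2 : ∑ j, c i * a j * (u j : ℝ) = a i * (c i * s) := by
        rw [show (a i : ℝ) * (c i * s) = c i * (a i * s) by ring, ← hsR, Finset.mul_sum]
        exact Finset.sum_congr rfl fun j _ => by ring
      rw [e1, e2] at hlt'
      have := lt_of_mul_lt_mul_left hlt' hai.le
      rw [hC]; push_cast; linarith
    right
    rcases ih (∑ j, (p j - u j)) (by omega) (fun j => p j - u j) (t + s) rfl (by simp [hp])
      (by rw [hA]; linarith) with h | ⟨y, hy, h⟩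
    · exact ⟨_, h, hlt⟩
    · exact ⟨y, hy, hlt.trans h⟩
  · have h2 := sum_small hbig i p (by omega)
    by_cases ht : 0 ≤ t
    · exact Or.inl (hnn t ht hfe)
    · right
      refine ⟨_, hnn 0 le_rfl (by simpa using h2), ?_⟩
      rw [kpt_lin, kpt_lin]
      have : (t:ℝ) < 0 := by exact_mod_cast (not_le.1 ht)
      push_cast
      nlinarith

lemma extreme_of_strict {n : ℕ} {S : Set (Fin n → ℝ)} {x : Fin n → ℝ} (hx : x ∈ S) (c : Fin n → ℝ)
    (h : ∀ y ∈ S, y ≠ x → ∑ j, c j * y j < ∑ j, c j * x j) :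
    x ∈ Set.extremePoints ℝ (convexHull ℝ S) := by
  set T : Set (Fin n → ℝ) := {y | y ≠ x → ∑ j, c j * y j < ∑ j, c j * x j} with hT
  have hlin : ∀ (y z : Fin n → ℝ) (α β : ℝ), ∑ j, c j * (α • y + β • z) j =
      α * ∑ j, c j * y j + β * ∑ j, c j * z j := by
    intro y z α β
    rw [Finset.mul_sum, Finset.mul_sum, ← Finset.sum_add_distrib]
    refine Finset.sum_congr rfl fun j _ => ?_
    simp only [Pi.add_apply, Pi.smul_apply, smul_eq_mul]; ring
  have hle : ∀ y ∈ T, ∑ j, c j * y j ≤ ∑ j, c j * x j := by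
    intro y hy
    by_cases e : y = x
    · rw [e]
    · exact (hy e).le
  have key : ∀ y ∈ T, ∀ z ∈ T, ∀ α β : ℝ, 0 < α → 0 < β → α + β = 1 → (y ≠ x ∨ z ≠ x) →
      ∑ j, c j * (α • y + β • z) j < ∑ j, c j * x j := by
    intro y hy z hz α β hα hβ hαβ hne
    rw [hlin]
    have h1 := hle y hy
    have h2 := hle z hz
    have e : ∑ j, c j * x j = α * ∑ j, c j * x j + β * ∑ j, c j * x j := by
      rw [← add_mul, hαβ, one_mul]
    rw [e]
    rcases hne with hne | hne
    · exact add_lt_add_of_lt_of_le (mul_lt_mul_of_pos_left (hy hne) hα)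
        (mul_le_mul_of_nonneg_left h2 hβ.le)
    · exact add_lt_add_of_le_of_lt (mul_le_mul_of_nonneg_left h1 hα.le)
        (mul_lt_mul_of_pos_left (hz hne) hβ)
  have hconv : Convex ℝ T := by
    rw [convex_iff_forall_pos]
    intro y hy z hz α β hα hβ hαβ hne
    refine key y hy z hz α β hα hβ hαβ ?_
    by_contra! hh
    apply hne
    rw [hh.1, hh.2, ← add_smul, hαβ, one_smul]
  have hsub : convexHull ℝ S ⊆ T := convexHull_min (fun y hy => h y hy) hconv
  refine mem_extremePoints.2 ⟨subset_convexHull ℝ S hx, ?_⟩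
  rintro y hy z hz ⟨α, β, hα, hβ, hαβ, e⟩
  by_contra hh
  have := key y (hsub hy) z (hsub hz) α β hα hβ hαβ (by tauto)
  rw [e] at this
  exact lt_irrefl _ this

lemma knap_le {n : ℕ} {a : Fin n → ℕ} {a₀ : ℕ} (ha : ∀ j, 0 < a j) {x : Fin n → ℝ}
    (hx : x ∈ knapPoints n a a₀) (i : Fin n) : x i ≤ a₀ := by
  refine le_trans ?_ hx.2.2
  have h1 : (a i : ℝ) * x i ≤ ∑ j, (a j : ℝ) * x j :=
    Finset.single_le_sum (f := fun j => (a j : ℝ) * x j)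
      (fun j _ => mul_nonneg (by positivity) (hx.2.1 j)) (Finset.mem_univ i)
  have h2 : (1:ℝ) ≤ a i := by exact_mod_cast ha i
  nlinarith [hx.2.1 i]

lemma knap_finite {n : ℕ} {a : Fin n → ℕ} {a₀ : ℕ} (ha : ∀ j, 0 < a j) :
    (knapPoints n a a₀).Finite := by
  refine Set.Finite.subset (Set.finite_range
    (fun (q : Fin n → Fin (a₀ + 1)) => (fun j => ((q j : ℕ) : ℝ) : Fin n → ℝ))) ?_
  intro x hx
  choose z hz using hx.1
  have h0 : ∀ j, 0 ≤ z j := fun j => by have := hx.2.1 j; rw [hz] at this; exact_mod_cast this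
  have h1 : ∀ j, z j ≤ a₀ := fun j => by
    have := knap_le ha hx j; rw [hz] at this; exact_mod_cast this
  refine ⟨fun j => ⟨(z j).toNat, by have := h0 j; have := h1 j; omega⟩, ?_⟩
  ext j
  simp only [hz]
  exact_mod_cast Int.toNat_of_nonneg (h0 j)

lemma vert_sub {n : ℕ} {a : Fin n → ℕ} {a₀ : ℕ} (ha : ∀ j, 0 < a j)
    (hbig : (Finset.univ.sup a) * (Finset.univ.sup a - 1) ≤ a₀) {x : Fin n → ℝ}
    (hx : x ∈ knapVert n a a₀) (hx0 : x ≠ 0) : ∃ i, x ∈ relaxKnapVert n a a₀ i := by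
  have hxK : x ∈ knapPoints n a a₀ := extremePoints_convexHull_subset hx
  have hnot : x ∉ convexHull ℝ (knapPoints n a a₀ \ {x}) := by
    intro hmem
    have := ((convex_convexHull ℝ _).mem_extremePoints_iff_mem_sdiff_convexHull_sdiff.1 hx).2
    exact this (convexHull_mono (Set.sdiff_subset_sdiff_left (subset_convexHull ℝ _)) hmem)
  obtain ⟨f, u, hfx, hfu⟩ := geometric_hahn_banach_point_closed (convex_convexHull ℝ _)
    (((knap_finite ha).subset Set.sdiff_subset).isClosed_convexHull ℝ) hnot
  set c : Fin n → ℝ := fun j => - f (Pi.single j 1) with hcdef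
  have hfc : ∀ y : Fin n → ℝ, ∑ j, c j * y j = - f y := by
    intro y
    conv_rhs => rw [pi_eq_sum_univ' y]
    simp only [map_sum, map_smul, smul_eq_mul, hcdef]
    rw [← Finset.sum_neg_distrib]
    refine Finset.sum_congr rfl fun j _ => ?_
    have : (fun k => if k = j then (1:ℝ) else 0) = Pi.single j 1 := by
      ext k; simp [Pi.single_apply]
    ring
  obtain ⟨δ, hδ, hgap⟩ : ∃ δ > 0, ∀ y ∈ knapPoints n a a₀, y ≠ x →
      ∑ j, c j * y j + δ < ∑ j, c j * x j := by
    refine ⟨u - f x, by linarith, fun y hy hne => ?_⟩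
    have := hfu y (subset_convexHull ℝ _ ⟨hy, hne⟩)
    rw [hfc, hfc]; linarith
  have h0K : (0 : Fin n → ℝ) ∈ knapPoints n a a₀ :=
    ⟨fun j => ⟨0, by simp⟩, fun j => by simp, by simp⟩
  have hcx : 0 < ∑ j, c j * x j := by
    have := hgap 0 h0K hx0.symm
    simp at this; linarith
  obtain ⟨b, -, hb⟩ : ∃ b ∈ Finset.univ, 0 < c b := by
    by_contra! hh
    have : ∑ j, c j * x j ≤ 0 := Finset.sum_nonpos fun j hj =>
      mul_nonpos_of_nonpos_of_nonneg (hh j hj) (hxK.2.1 j)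
    linarith
  obtain ⟨i, -, hi⟩ := Finset.exists_max_image Finset.univ (fun j => c j / (a j : ℝ)) ⟨b, Finset.mem_univ b⟩
  have haR : ∀ j, (0:ℝ) < a j := fun j => by exact_mod_cast ha j
  have hci : 0 < c i := by
    have h1 := hi b (Finset.mem_univ b)
    have h2 : 0 < c b / a b := div_pos hb (haR b)
    have h3 : 0 < c i / a i := h2.trans_le h1
    exact (div_pos_iff_of_pos_right (haR i)).1 h3
  have hratio : ∀ j, c j * a i ≤ c i * a j := fun j =>
    (div_le_div_iff₀ (haR j) (haR i)).1 (hi j (Finset.mem_univ j))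
  set ε : ℝ := δ / (a₀ + 1) with hε
  have hεpos : 0 < ε := by positivity
  have hεδ : ε * a₀ < δ := by
    rw [hε, div_mul_eq_mul_div, div_lt_iff₀ (by positivity)]; nlinarith
  set c' : Fin n → ℝ := fun j => c j + (if j = i then ε else 0) with hc'
  have hc'lin : ∀ y : Fin n → ℝ, ∑ j, c' j * y j = ∑ j, c j * y j + ε * y i := by
    intro y
    simp [hc', add_mul, Finset.sum_add_distrib]
  have hmax : ∀ y ∈ knapPoints n a a₀, y ≠ x → ∑ j, c' j * y j < ∑ j, c' j * x j := by
    intro y hy hne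
    rw [hc'lin, hc'lin]
    have h1 := hgap y hy hne
    have h2 := mul_le_mul_of_nonneg_left (knap_le ha hy i) hεpos.le
    have h3 := mul_nonneg hεpos.le (hxK.2.1 i)
    linarith
  refine ⟨i, extreme_of_strict ⟨hxK.1, fun j _ => hxK.2.1 j, hxK.2.2⟩ c' ?_⟩
  intro y hy hne
  obtain ⟨p, t, hp, rfl⟩ := exists_kpt hy
  rcases improve ha hbig i c' (by simp [hc']; linarith) (fun j hj => by
    simp only [hc', hj, if_false, if_true, add_zero]
    have := hratio j
    have := mul_pos hεpos (haR j)
    linarith) _ p t rfl hp ((kpt_mem_iff i p t).1 hy) with h | ⟨z, hz, h⟩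
  · exact hmax _ h hne
  · by_cases e : z = x
    · rw [← e]; exact h
    · exact h.trans (hmax z hz e)

lemma zero_vert {n : ℕ} {a : Fin n → ℕ} {a₀ : ℕ} : (0 : Fin n → ℝ) ∈ knapVert n a a₀ := by
  refine extreme_of_strict ⟨fun j => ⟨0, by simp⟩, fun j => by simp, by simp⟩ (fun _ => -1) ?_
  intro y hy hne
  obtain ⟨b, hb⟩ := Function.ne_iff.1 hne
  have hb' : 0 < y b := lt_of_le_of_ne (hy.2.1 b) (fun e => hb e.symm)
  have : 0 < ∑ j, y j := Finset.sum_pos' (fun j _ => hy.2.1 j) ⟨b, Finset.mem_univ b, hb'⟩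
  simpa using this

/-- If `a₀ ≥ α₁(α₁ − 1)` where `α₁ = max aⱼ`, then `𝒩(a,a₀) = ∪_{i=0}^{n} Nᵢ` (with
`N₀ = {0}`), and consequently
`|𝒩(a,a₀)| ≤ 1 + ∑ᵢ C(⌊log₂ aᵢ⌋ + n − 1, n − 1) ≤ 1 + n(⌊log₂ α₁⌋ + 1)^{n-1}`. -/
theorem knapVert_eq_union_of_large_rhs (n : ℕ) (a : Fin n → ℕ) (a₀ : ℕ)
    (ha : ∀ j, 0 < a j)
    (α₁ : ℕ) (hα₁ : α₁ = Finset.univ.sup a)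
    (hbig : α₁ * (α₁ - 1) ≤ a₀) :
    (knapVert n a a₀ = {(0 : Fin n → ℝ)} ∪ ⋃ i, relaxKnapVert n a a₀ i) ∧
    (knapVert n a a₀).Finite ∧
    (knapVert n a a₀).ncard ≤ 1 + ∑ i, Nat.choose (Nat.log 2 (a i) + n - 1) (n - 1) ∧
    1 + ∑ i, Nat.choose (Nat.log 2 (a i) + n - 1) (n - 1) ≤
      1 + n * (Nat.log 2 α₁ + 1) ^ (n - 1) := by
  classical
  subst hα₁
  have hE : knapVert n a a₀ = {(0 : Fin n → ℝ)} ∪ ⋃ i, relaxKnapVert n a a₀ i := by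
    apply Set.Subset.antisymm
    · intro x hx
      by_cases h0 : x = 0
      · left; exact h0
      · right; exact Set.mem_iUnion.2 (vert_sub ha hbig hx h0)
    · apply Set.union_subset
      · rintro x rfl; exact zero_vert
      · exact Set.iUnion_subset fun i => relax_sub ha hbig i
  have hfin : (⋃ i, relaxKnapVert n a a₀ i).Finite := Set.finite_iUnion fun i => (relax_card ha i).1
  refine ⟨hE, ?_, ?_, ?_⟩
  · rw [hE]; exact (Set.finite_singleton _).union hfin
  · rw [hE]
    refine (Set.ncard_union_le _ _).trans ?_
    rw [Set.ncard_singleton]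
    refine Nat.add_le_add_left ?_ 1
    have hU : (⋃ i, relaxKnapVert n a a₀ i) =
        ((Finset.univ.biUnion fun i => (relax_card (a₀ := a₀) ha i).1.toFinset : Finset (Fin n → ℝ)) :
          Set (Fin n → ℝ)) := by
      ext x; simp
    rw [hU, Set.ncard_coe_finset]
    refine Finset.card_biUnion_le.trans (Finset.sum_le_sum fun i _ => ?_)
    rw [← Set.ncard_eq_toFinset_card _ (relax_card (a₀ := a₀) ha i).1]
    exact (relax_card ha i).2
  · refine Nat.add_le_add_left ?_ 1
    calc ∑ i, Nat.choose (Nat.log 2 (a i) + n - 1) (n - 1)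
        ≤ ∑ _i : Fin n, (Nat.log 2 (Finset.univ.sup a) + 1) ^ (n - 1) := by
          refine Finset.sum_le_sum fun i _ => ?_
          have hn : 0 < n := i.pos
          rw [Nat.add_sub_assoc hn]
          refine (choose_le_pow' _ _).trans (Nat.pow_le_pow_left ?_ _)
          exact Nat.add_le_add_right (Nat.log_mono_right (Finset.le_sup (Finset.mem_univ i))) 1
      _ = _ := by simp
end

section
/- Define β₁ = 1, β₂ = 2, and β_{s+1} = 2β_s + β_{s−1} for s ≥ 2. For natural numbers a, b, c, if a < β_{s−1} then |𝒩(a,b,c)| < 2s. -/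
/-- `𝒩(a,b,c)`: the set of vertices (extreme points) of the convex hull of
`{(x,y) ∈ ℤ² : x ≥ 0, y ≥ 0, ax + by ≤ c}`, the two-dimensional knapsack polytope. -/
def twoKnapVert (a b c : ℕ) : Set (ℝ × ℝ) :=
  Set.extremePoints ℝ (convexHull ℝ
    {p : ℝ × ℝ | (∃ x : ℤ, p.1 = (x : ℝ)) ∧ (∃ y : ℤ, p.2 = (y : ℝ)) ∧
      0 ≤ p.1 ∧ 0 ≤ p.2 ∧ (a : ℝ) * p.1 + (b : ℝ) * p.2 ≤ (c : ℝ)})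

/-- The sequence `β₁ = 1, β₂ = 2, β_{s+1} = 2β_s + β_{s−1}` (`s ≥ 2`), extended by
`β₀ = 0` (which is consistent with the recurrence). -/
def beta : ℕ → ℕ
  | 0 => 0
  | 1 => 1
  | n + 2 => 2 * beta (n + 1) + beta n


theorem knap_wrap (a b c Y y0 X0 : ℤ) (ha : 0 < a)
    (ex : ∃ y X, y0 < y ∧ y ≤ Y ∧ a*X+b*y ≤ c ∧ a*X0+b*y0 < a*X+b*y) :
    ∃ x l t : ℤ, 0 < x ∧ 0 < t ∧ IsCoprime x l ∧ 0 < a*l+b*x ∧ y0+t*x ≤ Y ∧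
      a*(X0+t*l)+b*(y0+t*x) ≤ c ∧
      (∀ y X, y0 < y → y ≤ Y → a*X+b*y ≤ c →
        x*(a*(X-X0)+b*(y-y0)) ≤ (a*l+b*x)*(y-y0)) ∧
      (∀ y X, y0+t*x < y → y ≤ Y → a*X+b*y ≤ c →
        x*(a*(X-X0)+b*(y-y0)) < (a*l+b*x)*(y-y0)) := by
  obtain ⟨ye, Xe, hy1, hy2, hf, hgt⟩ := ex
  let F : ℤ → ℤ := fun y => (c - b*y)/a
  have hF : ∀ y, a*F y + b*y ≤ c := by
    intro y
    have := Int.mul_ediv_self_le (x := c - b*y) (k := a) ha.ne'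
    simp only [F]; linarith
  have hFm : ∀ y X, a*X+b*y ≤ c → X ≤ F y := by
    intro y X h
    simp only [F]
    rw [Int.le_ediv_iff_mul_le ha]; linarith
  let sl : ℤ → ℚ := fun y => ((a*(F y - X0)+b*(y-y0) : ℤ) : ℚ) / ((y - y0 : ℤ) : ℚ)
  obtain ⟨m, hm, hmax⟩ := Finset.exists_max_image (Finset.Ioc y0 Y) sl ⟨ye, by simp [hy1, hy2]⟩
  obtain ⟨z, hz, hzmax⟩ := Finset.exists_max_image
    ((Finset.Ioc y0 Y).filter (fun y => sl y = sl m)) id ⟨m, by simp [hm]⟩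
  simp only [Finset.mem_filter, Finset.mem_Ioc, id] at hz hzmax hmax
  obtain ⟨⟨hz1, hz2⟩, hz3⟩ := hz
  have key : ∀ y, y0 < y → y ≤ Y →
      (z-y0)*(a*(F y-X0)+b*(y-y0)) ≤ (a*(F z - X0)+b*(z-y0))*(y-y0) := by
    intro y h1 h2
    have h := hmax y ⟨h1, h2⟩
    rw [← hz3] at h
    simp only [sl] at h
    rw [div_le_div_iff₀ (by exact_mod_cast (by linarith : 0 < y - y0))
      (by exact_mod_cast (by linarith : 0 < z - y0))] at h
    have h' : (a*(F y - X0)+b*(y-y0))*(z-y0) ≤ (a*(F z - X0)+b*(z-y0))*(y-y0) := by exact_mod_cast h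
    linarith
  have keys : ∀ y, z < y → y ≤ Y →
      (z-y0)*(a*(F y-X0)+b*(y-y0)) < (a*(F z - X0)+b*(z-y0))*(y-y0) := by
    intro y h1 h2
    refine lt_of_le_of_ne (key y (by linarith) h2) ?_
    intro he
    have : sl y = sl m := by
      rw [← hz3]
      simp only [sl]
      rw [div_eq_div_iff (by exact_mod_cast (by linarith : y - y0 ≠ 0))
        (by exact_mod_cast (by linarith : z - y0 ≠ 0))]
      have h' : (a*(F y - X0)+b*(y-y0))*(z-y0) = (a*(F z - X0)+b*(z-y0))*(y-y0) := by linarith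
      exact_mod_cast h'
    have := hzmax y ⟨⟨by linarith, h2⟩, this⟩
    linarith
  have hzpos : 0 < z - y0 := by linarith
  obtain ⟨g, x, l, hg, hco, hx, hl⟩ :
      ∃ g x l : ℤ, 0 < g ∧ IsCoprime x l ∧ z - y0 = x * g ∧ F z - X0 = l * g := by
    have hgp : 0 < Int.gcd (z-y0) (F z - X0) := Int.gcd_pos_of_ne_zero_left _ hzpos.ne'
    obtain ⟨x, l, hc, hx, hl⟩ := Int.exists_gcd_one hgp
    exact ⟨_, x, l, by exact_mod_cast hgp, Int.isCoprime_iff_gcd_eq_one.mpr hc, hx, hl⟩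
  have hxpos : 0 < x := by
    rw [hx] at hzpos
    exact pos_of_mul_pos_left hzpos hg.le
  have e1 : a*(F z - X0)+b*(z-y0) = g * (a*l+b*x) := by rw [hl, hx]; ring
  have gen : ∀ y X, y0 < y → a*X+b*y ≤ c →
      x*(a*(X-X0)+b*(y-y0)) ≤ x*(a*(F y-X0)+b*(y-y0)) := by
    intro y X h1 h2
    have := hFm y X h2
    gcongr
  refine ⟨x, l, g, hxpos, hg, hco, ?_, ?_, ?_, ?_, ?_⟩
  · have h1 := key ye hy1 hy2
    have h2 := hFm ye Xe hf
    have h3 : 0 < a*(F ye-X0)+b*(ye-y0) := by nlinarith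
    have h4 : 0 < (a*(F z - X0)+b*(z-y0))*(ye-y0) := lt_of_lt_of_le (mul_pos hzpos h3) h1
    have h5 := pos_of_mul_pos_left h4 (by linarith)
    rw [e1] at h5
    exact pos_of_mul_pos_right h5 hg.le
  · linarith
  · have := hF z
    have h1 : X0 + g*l = F z := by linarith
    have h2 : y0 + g*x = z := by linarith
    rw [h1, h2]; exact this
  · intro y X h1 h2 h3
    refine (gen y X h1 h3).trans ?_
    have := key y h1 h2
    rw [e1, hx] at this
    have h5 : g * (x*(a*(F y-X0)+b*(y-y0))) ≤ g * ((a*l+b*x)*(y-y0)) := by linarith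
    exact le_of_mul_le_mul_left h5 hg
  · intro y X h1 h2 h3
    have hzy : z < y := by linarith
    refine (gen y X (by linarith) h3).trans_lt ?_
    have := keys y hzy h2
    rw [e1, hx] at this
    have h5 : g * (x*(a*(F y-X0)+b*(y-y0))) < g * ((a*l+b*x)*(y-y0)) := by linarith
    exact lt_of_mul_lt_mul_left h5 hg.le

/-- vertex condition -/
def KVC (a b c Y y X : ℤ) : Prop :=
  0 ≤ y ∧ y ≤ Y ∧ a*X+b*y ≤ c ∧
  ∀ y1 X1 y2 X2 : ℤ, 0 ≤ y1 → y1 < y → y < y2 → y2 ≤ Y → a*X1+b*y1 ≤ c → a*X2+b*y2 ≤ c →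
    X1*(y2-y)+X2*(y-y1) < X*(y2-y1)

def KRec (a b c y X : ℤ) : Prop :=
  ∀ y' X' : ℤ, 0 ≤ y' → y' < y → a*X'+b*y' ≤ c → a*X'+b*y' < a*X+b*y

def KLeft (a b c Y y : ℤ) : Prop := ∃ X, KVC a b c Y y X ∧ KRec a b c y X

theorem bezout_small (n m : ℤ) (hn : 0 < n) (h : IsCoprime n m) :
    ∃ n' m', n*m' - m*n' = 1 ∧ 0 ≤ n' ∧ n' < n := by
  obtain ⟨u, w, huw⟩ := h
  refine ⟨(-w) % n, u + m * (-((-w)/n)), ?_, Int.emod_nonneg _ hn.ne', Int.emod_lt_of_pos _ hn⟩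
  have := Int.emod_add_mul_ediv (-w) n
  have h2 : (-w) % n = -w - n * ((-w)/n) := by linarith
  rw [h2]; linear_combination huw

/-- facts about the point after wrapping -/
theorem rec_step (a b c Y y0 X0 x l t : ℤ) (hx : 0 < x) (ht : 0 < t)
    (hd : 0 < a*l+b*x) (hY : y0+t*x ≤ Y) (hr : KRec a b c y0 X0)
    (hs : ∀ y X, y0 < y → y ≤ Y → a*X+b*y ≤ c →
        x*(a*(X-X0)+b*(y-y0)) ≤ (a*l+b*x)*(y-y0))
    (hself : ∀ X, a*X+b*y0 ≤ c → X ≤ X0) (ha : 0 < a) :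
    KRec a b c (y0+t*x) (X0+t*l) := by
  intro y' X' h1 h2 h3
  have htd := mul_pos ht hd
  rcases lt_trichotomy y' y0 with h | h | h
  · have := hr y' X' h1 h h3
    nlinarith
  · subst h
    have := hself X' h3
    nlinarith
  · have := hs y' X' h (by linarith) h3
    have h4 : (a*l+b*x)*(y'-y0) < (a*l+b*x)*(t*x) := by
      apply mul_lt_mul_of_pos_left _ hd; linarith
    have h5 : x*(a*(X'-X0)+b*(y'-y0)) < x * (t*(a*l+b*x)) := by linarith
    have h6 := lt_of_mul_lt_mul_left h5 hx.le
    linarith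

theorem self_step (a b c Y y0 X0 x l t : ℤ) (hx : 0 < x) (ht : 0 < t)
    (hY : y0+t*x ≤ Y)
    (hs : ∀ y X, y0 < y → y ≤ Y → a*X+b*y ≤ c →
        x*(a*(X-X0)+b*(y-y0)) ≤ (a*l+b*x)*(y-y0)) (ha : 0 < a) :
    ∀ X, a*X+b*(y0+t*x) ≤ c → X ≤ X0+t*l := by
  intro X h
  have htx := mul_pos ht hx
  have := hs _ X (by linarith) hY h
  have h2 : x*(a*(X-X0)+b*(y0+t*x-y0)) ≤ x*(t*(a*l+b*x)) := by linarith
  have h3 := le_of_mul_le_mul_left h2 hx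
  have h4 : a * X ≤ a * (X0+t*l) := by linarith
  exact le_of_mul_le_mul_left h4 ha

theorem left_far (a b c Y y0 X0 x l t : ℤ) (h0 : a*X0+b*y0 ≤ c) (hy0 : 0 ≤ y0) (hx : 0 < x)
    (hY : y0+t*x ≤ Y) (ht : 0 < t)
    (hf : a*(X0+t*l)+b*(y0+t*x) ≤ c) (ha : 0 < a)
    (hs : ∀ y X, y0 < y → y ≤ Y → a*X+b*y ≤ c →
        x*(a*(X-X0)+b*(y-y0)) ≤ (a*l+b*x)*(y-y0)) (y : ℤ)
    (hl : KLeft a b c Y y) (hy : y0 < y) : y0+t*x ≤ y := by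
  by_contra hlt
  push Not at hlt
  obtain ⟨X, ⟨h1, h2, h3, h4⟩, -⟩ := hl
  have := h4 y0 X0 _ _ hy0 hy hlt hY h0 hf
  have h5 := hs y X hy h2 h3
  have h6 : a*(x*(X-X0)) ≤ a*(l*(y-y0)) := by linarith
  have h7 := le_of_mul_le_mul_left h6 ha
  have h8 := mul_le_mul_of_nonneg_left h7 ht.le
  nlinarith

theorem count_step (W : Finset ℤ) (y0 y1 : ℤ) (k : ℕ)
    (hW : ∀ y ∈ W, y0 < y → y1 ≤ y)
    (hc : k + 1 ≤ (W.filter (fun y => y0 < y)).card) :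
    k ≤ (W.filter (fun y => y1 < y)).card := by
  have : W.filter (fun y => y0 < y) ⊆ insert y1 (W.filter (fun y => y1 < y)) := by
    intro y hy
    simp only [Finset.mem_filter, Finset.mem_insert] at hy ⊢
    rcases (hW y hy.1 hy.2).eq_or_lt with h | h
    · exact Or.inl h.symm
    · exact Or.inr ⟨hy.1, h⟩
  have h1 := Finset.card_le_card this
  have h2 := Finset.card_insert_le y1 (W.filter (fun y => y1 < y))
  omega

theorem exists_of_count (a b c Y y0 X0 : ℤ) (h0 : a*X0+b*y0 ≤ c) (hy0 : 0 ≤ y0)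
    (W : Finset ℤ) (hW : ∀ y ∈ W, KLeft a b c Y y) (k : ℕ)
    (hc : k + 1 ≤ (W.filter (fun y => y0 < y)).card) :
    ∃ y X, y0 < y ∧ y ≤ Y ∧ a*X+b*y ≤ c ∧ a*X0+b*y0 < a*X+b*y := by
  obtain ⟨y, hy⟩ := Finset.card_pos.mp (show 0 < (W.filter (fun y => y0 < y)).card by omega)
  simp only [Finset.mem_filter] at hy
  obtain ⟨X, ⟨h1, h2, h3, h4⟩, h5⟩ := hW y hy.1
  exact ⟨y, X, hy.2, h2, h3, h5 y0 X0 hy0 hy.2 h0⟩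

theorem kappa_pos (a b c Y y0 X0 x l t d lf : ℤ) (hx : 0 < x) (ht : 0 < t) (ha : 0 < a)
    (hd : 0 < a*l+b*x) (hY : y0+t*x ≤ Y)
    (hf : a*(X0+t*l)+b*(y0+t*x) ≤ c)
    (hs : ∀ y X, y0 < y → y ≤ Y → a*X+b*y ≤ c →
        x*(a*(X-X0)+b*(y-y0)) ≤ (a*l+b*x)*(y-y0))
    (hd1 : 0 < d) (hdx : d < x) (hdet : l*d - lf*x = 1) : a*lf+b*d < 0 := by
  by_contra hk
  push Not at hk
  have hxt : x ≤ t*x := by nlinarith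
  have hdt : (a*l+b*x) ≤ t*(a*l+b*x) := by nlinarith
  have := hs (y0+(x-d)) (X0+(l-lf)) (by linarith) (by linarith) (by linarith)
  have h2 : a * (l*d-lf*x) ≤ 0 := by linarith
  rw [hdet] at h2
  linarith

theorem kappa_big (a b c y0 X0 x l t d lf : ℤ) (ht : 0 < t)
    (hd : 0 < a*l+b*x)
    (hf : a*(X0+t*l)+b*(y0+t*x) ≤ c) (hr : KRec a b c y0 X0)
    (hd1 : 0 < d) (hdy : d ≤ y0) (hk : a*lf+b*d < 0) : a*l+b*x < -(a*lf+b*d) := by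
  by_contra hcon
  push Not at hcon
  have hdt : (a*l+b*x) ≤ t*(a*l+b*x) := by nlinarith
  have := hr (y0-d) (X0-lf) (by linarith) (by linarith) (by linarith)
  linarith

theorem beta_rec (i : ℕ) : (beta (i+2) : ℤ) = 2 * beta (i+1) + beta i := by
  simp [beta]

set_option maxHeartbeats 2000000 in
theorem knap_ind (a b c Y : ℤ) (ha : 0 < a) (W : Finset ℤ) (hW : ∀ y ∈ W, KLeft a b c Y y)
    (k : ℕ) : ∀ (i : ℕ) (Y0 y0 X0 x l d lf : ℤ),
    a*X0+b*y0 ≤ c → 0 ≤ Y0 → Y0 + x ≤ y0 → KRec a b c y0 X0 →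
    (∀ X, a*X+b*y0 ≤ c → X ≤ X0) →
    0 < d → d ≤ x → 0 < a*l+b*x → a*lf+b*d < 0 → l*d - lf*x = 1 →
    (∀ y X, y0 < y → y ≤ Y → a*X+b*y ≤ c →
        x*(a*(X-X0)+b*(y-y0)) < (a*l+b*x)*(y-y0)) →
    ((d ≤ Y0 ∧ a*l+b*x < -(a*lf+b*d) ∧ (beta i : ℤ) ≤ x ∧ (beta (i+1) : ℤ) ≤ 2*x+d) ∨
      ((beta (i+1) : ℤ) ≤ x+d ∧ (beta i : ℤ) ≤ d)) →
    k ≤ (W.filter (fun y => y0 < y)).card → (beta (i+1+k) : ℤ) ≤ a := by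
  induction k with
  | zero =>
    intro i Y0 y0 X0 x l d lf h0 hY0 hy0 hr hself hd hdx hδ hκ hdet hs hst hc
    have e : a = x * (-(a*lf+b*d)) + d*(a*l+b*x) := by linear_combination (-a) * hdet
    have hx : 0 < x := by linarith
    simp only [Nat.add_zero]
    rcases hst with ⟨_, h1, h2, h3⟩ | ⟨h1, h2⟩
    · have : x * 2 ≤ x * (-(a*lf+b*d)) := by gcongr; omega
      have : d * 1 ≤ d * (a*l+b*x) := by gcongr; omega
      linarith
    · have : x * 1 ≤ x * (-(a*lf+b*d)) := by gcongr; omega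
      have : d * 1 ≤ d * (a*l+b*x) := by gcongr; omega
      linarith
  | succ k ih =>
    intro i Y0 y0 X0 x l d lf h0 hY0 hy0 hr hself hd hdx hδ hκ hdet hs hst hc
    have hx : 0 < x := by linarith
    have hy0' : 0 ≤ y0 := by linarith
    obtain ⟨x', l', t, hx', ht, hco, hδ', hY', hf', hs', hss'⟩ :=
      knap_wrap a b c Y y0 X0 ha (exists_of_count a b c Y y0 X0 h0 hy0' W hW k hc)
    have htx : x' ≤ t*x' := by nlinarith
    have htδ : (a*l'+b*x') ≤ t*(a*l'+b*x') := by nlinarith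
    -- coordinates of the new edge
    obtain ⟨ν, hν⟩ : ∃ ν, ν = l'*d - x'*lf := ⟨_, rfl⟩
    obtain ⟨μ, hμ⟩ : ∃ μ, μ = x'*l - l'*x := ⟨_, rfl⟩
    have ex : x' = ν*x+μ*d := by rw [hν, hμ]; linear_combination (-x') * hdet
    have el : l' = ν*l+μ*lf := by rw [hν, hμ]; linear_combination (-l') * hdet
    have eδ : a*l'+b*x' = ν*(a*l+b*x) + μ*(a*lf+b*d) := by rw [ex, el]; ring
    have hμpos : 0 < μ := by
      have h1 := hs (y0+t*x') (X0+t*l') (by linarith) hY' hf'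
      have h2 : 0 < t*(a*μ) := by rw [hμ]; linarith
      exact pos_of_mul_pos_right (pos_of_mul_pos_right h2 ht.le) ha.le
    have hνpos : 0 < ν := by
      have : 0 < ν*(a*l+b*x) := by nlinarith
      exact pos_of_mul_pos_left this hδ.le
    have hcop : IsCoprime ν μ := by
      obtain ⟨u, w, huw⟩ := hco
      exact ⟨u*x+w*l, u*d+w*lf, by rw [ex, el] at huw; linear_combination huw⟩
    obtain ⟨ν', μ', hdet', hν'0, hν'⟩ := bezout_small ν μ hνpos hcop
    have hμ'pos : 0 < μ' := by
      have : 0 < ν*μ' := by nlinarith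
      exact pos_of_mul_pos_right this hνpos.le
    have hμ'le : μ' ≤ μ := by
      have h1 : μ*ν' ≤ μ*(ν-1) := by gcongr; omega
      have h2 : ν*μ' ≤ ν*μ := by linarith
      exact le_of_mul_le_mul_left h2 hνpos
    obtain ⟨d', hd'⟩ : ∃ d', d' = ν'*x+μ'*d := ⟨_, rfl⟩
    obtain ⟨lf', hlf'⟩ : ∃ lf', lf' = ν'*l+μ'*lf := ⟨_, rfl⟩
    have hd'pos : 0 < d' := by
      have := mul_nonneg hν'0 hx.le
      have := mul_pos hμ'pos hd
      linarith
    have hd'lt : d' < x' := by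
      have h1 : ν'*x < ν*x := by gcongr
      have h2 : μ'*d ≤ μ*d := by gcongr
      linarith
    have hdd : l'*d' - lf'*x' = 1 := by
      rw [el, hd', hlf', ex]; linear_combination (l*d-lf*x)*hdet' + hdet
    have hκ' : a*lf'+b*d' < 0 :=
      kappa_pos a b c Y y0 X0 x' l' t d' lf' hx' ht ha hδ' hY' hf' hs' hd'pos hd'lt hdd
    have hstate : ((d' ≤ y0 ∧ a*l'+b*x' < -(a*lf'+b*d') ∧ (beta (i+1) : ℤ) ≤ x' ∧
          (beta (i+1+1) : ℤ) ≤ 2*x'+d') ∨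
        ((beta (i+1+1) : ℤ) ≤ x'+d' ∧ (beta (i+1) : ℤ) ≤ d')) := by
      have hb := beta_rec i
      have hb0 : (0:ℤ) ≤ beta i := by positivity
      by_cases hw : d' ≤ y0
      · left
        refine ⟨hw, kappa_big a b c y0 X0 x' l' t d' lf' ht hδ' hf' hr hd'pos hw hκ', ?_⟩
        rcases hst with ⟨h0', h1, h2, h3⟩ | ⟨h1, h2⟩
        · have hνμ : μ + 1 ≤ ν := by
            by_contra hcon
            have h5 : ν ≤ μ := by omega
            have h6 := mul_le_mul_of_nonneg_right h5 hδ.le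
            have h7 := mul_lt_mul_of_pos_left h1 hμpos
            linarith
          have hν'1 : 1 ≤ ν' := by
            by_contra hcon
            have : ν' = 0 := by omega
            rw [this] at hdet'
            have h6 : ν * 1 ≤ ν * μ' := by gcongr; omega
            linarith
          have q1 : 2*x ≤ ν*x := by gcongr; omega
          have q2 : 1*d ≤ μ*d := by gcongr; omega
          have q3 : 1*x ≤ ν'*x := by gcongr
          have q4 : 1*d ≤ μ'*d := by gcongr; omega
          constructor <;> linarith
        · have q1 : 1*x ≤ ν*x := by gcongr; omega
          have q2 : 1*d ≤ μ*d := by gcongr; omega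
          have q3 : 0*x ≤ ν'*x := by gcongr
          have q4 : 1*d ≤ μ'*d := by gcongr; omega
          constructor <;> linarith
      · right
        push Not at hw
        rcases hst with ⟨h0', h1, h2, h3⟩ | ⟨h1, h2⟩
        · have hνμ : μ + 1 ≤ ν := by
            by_contra hcon
            have h5 : ν ≤ μ := by omega
            have h6 := mul_le_mul_of_nonneg_right h5 hδ.le
            have h7 := mul_lt_mul_of_pos_left h1 hμpos
            linarith
          have hνμ' : μ' ≤ ν' := by
            by_contra hcon
            have h5 : ν' + 1 ≤ μ' := by omega
            have h6 := mul_le_mul_of_nonneg_left h5 hνpos.le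
            have h7 := mul_le_mul_of_nonneg_right hνμ hν'0
            linarith
          have hν'2 : 2 ≤ ν' := by
            by_contra hcon
            have e1 : ν' = 1 := by omega
            have e2 : μ' = 1 := by omega
            rw [hd', e1, e2] at hw
            linarith
          have q1 : 3*x ≤ ν*x := by gcongr; omega
          have q2 : 1*d ≤ μ*d := by gcongr; omega
          have q3 : 2*x ≤ ν'*x := by gcongr
          have q4 : 1*d ≤ μ'*d := by gcongr; omega
          constructor <;> linarith
        · have hν'1 : 1 ≤ ν' := by
            by_contra hcon
            have e1 : ν' = 0 := by omega
            have e2 : ν * μ' = 1 := by rw [e1] at hdet'; linarith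
            have e3 : μ' = 1 := by
              have : 1 ≤ ν := hνpos
              nlinarith
            rw [hd', e1, e3] at hw
            linarith
          have q1 : 2*x ≤ ν*x := by gcongr; omega
          have q2 : 1*d ≤ μ*d := by gcongr; omega
          have q3 : 1*x ≤ ν'*x := by gcongr
          have q4 : 1*d ≤ μ'*d := by gcongr; omega
          constructor <;> linarith
    have := ih (i+1) y0 (y0+t*x') (X0+t*l') x' l' d' lf' hf' hy0' (by linarith)
      (rec_step a b c Y y0 X0 x' l' t hx' ht hδ' hY' hr hs' hself ha)
      (self_step a b c Y y0 X0 x' l' t hx' ht hY' hs' ha) hd'pos hd'lt.le hδ' hκ' hdd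
      (by
        intro y X h1 h2 h3
        have := hss' y X h1 h2 h3
        linarith) hstate
      (count_step W y0 _ k (fun y hy hlt =>
        left_far a b c Y y0 X0 x' l' t h0 hy0' hx' hY' ht hf' ha hs' y (hW y hy) hlt) hc)
    rwa [show i+1+(k+1) = i+1+1+k by ring]

theorem knap_left (a b c Y : ℤ) (ha : 0 < a) (W : Finset ℤ) (hW : ∀ y ∈ W, KLeft a b c Y y)
    (n : ℕ) (hn : n ≤ W.card) : (beta n : ℤ) ≤ a := by
  match n, hn with
  | 0, _ => simp [beta]; omega
  | 1, _ => simp [beta]; omega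
  | k+2, hn =>
    have hf0 : a*(c/a)+b*0 ≤ c := by
      have := Int.mul_ediv_self_le (x := c) (k := a) ha.ne'
      linarith
    have hlt : c < a*(c/a) + a := by
      have := Int.lt_mul_ediv_self_add (x := c) ha
      linarith
    have hself : ∀ X, a*X+b*0 ≤ c → X ≤ c/a := by
      intro X h
      rw [Int.le_ediv_iff_mul_le ha]; linarith
    have hr : KRec a b c 0 (c/a) := by
      intro y' X' h1 h2; omega
    have hcm : (k+1) + 1 ≤ (W.filter (fun y => -1 < y)).card := by
      rw [Finset.filter_true_of_mem]
      · omega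
      · intro y hy
        obtain ⟨X, ⟨h1, _⟩, _⟩ := hW y hy
        omega
    have hc := count_step W (-1) 0 (k+1) (fun y _ h => by omega) hcm
    obtain ⟨x, l, t, hx, ht, hco, hδ, hY', hf', hs', hss'⟩ :=
      knap_wrap a b c Y 0 (c/a) ha (exists_of_count a b c Y 0 (c/a) hf0 le_rfl W hW k hc)
    have htx : x ≤ t*x := by nlinarith
    have htδ : (a*l+b*x) ≤ t*(a*l+b*x) := by nlinarith
    obtain ⟨d, lf, hd, hdx, hdet⟩ : ∃ d lf : ℤ, 0 < d ∧ d ≤ x ∧ l*d - lf*x = 1 := by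
      obtain ⟨n', m', h1, h2, h3⟩ := bezout_small x (-l) hx hco.neg_right
      rcases h2.eq_or_lt with h | h
      · refine ⟨x, l - m', hx, le_rfl, ?_⟩
        rw [← h] at h1; linarith
      · exact ⟨n', -m', h, h3.le, by linarith⟩
    have hκ : a*lf+b*d < 0 := by
      rcases hdx.eq_or_lt with h | h
      · have h1 : x * (l - lf) = 1 := by rw [h] at hdet; linarith
        have h2 : x = 1 := Int.eq_one_of_mul_eq_one_right hx.le h1
        have h3 : l - lf = 1 := by rw [h2] at h1; linarith
        have h4 : lf = l - 1 := by linarith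
        rw [h4, h]
        linarith
      · exact kappa_pos a b c Y 0 (c/a) x l t d lf hx ht ha hδ hY' hf' hs' hd h hdet
    have := knap_ind a b c Y ha W hW k 1 0 (0+t*x) (c/a+t*l) x l d lf hf' le_rfl (by linarith)
      (rec_step a b c Y 0 (c/a) x l t hx ht hδ hY' hr hs' hself ha)
      (self_step a b c Y 0 (c/a) x l t hx ht hY' hs' ha) hd hdx hδ hκ hdet
      (by
        intro y X h1 h2 h3
        have := hss' y X h1 h2 h3
        linarith) (by right; simp [beta]; omega)
      (count_step W 0 _ k (fun y hy hlt =>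
        left_far a b c Y 0 (c/a) x l t hf0 le_rfl hx hY' ht hf' ha hs' y (hW y hy) hlt) hc)
    rwa [show k+2 = 1+1+k by ring]

def knapS (a b c : ℕ) : Set (ℝ × ℝ) :=
  {p : ℝ × ℝ | (∃ x : ℤ, p.1 = (x : ℝ)) ∧ (∃ y : ℤ, p.2 = (y : ℝ)) ∧
      0 ≤ p.1 ∧ 0 ≤ p.2 ∧ (a : ℝ) * p.1 + (b : ℝ) * p.2 ≤ (c : ℝ)}

theorem mem_knapS (a b c : ℕ) (X y : ℤ) (h1 : 0 ≤ X) (h2 : 0 ≤ y) (h3 : a*X+b*y ≤ c) :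
    (((X:ℝ), (y:ℝ)) : ℝ × ℝ) ∈ knapS a b c :=
  ⟨⟨X, rfl⟩, ⟨y, rfl⟩, by simpa using h1, by simpa using h2, by
    show (a:ℝ) * (X:ℝ) + (b:ℝ) * (y:ℝ) ≤ (c:ℝ)
    exact_mod_cast h3⟩

theorem vert_coords (a b c : ℕ) (p : ℝ × ℝ) (hp : p ∈ twoKnapVert a b c) :
    ∃ X y : ℤ, p = ((X:ℝ), (y:ℝ)) ∧ 0 ≤ X ∧ 0 ≤ y ∧ a*X+b*y ≤ c := by
  obtain ⟨⟨X, hX⟩, ⟨y, hy⟩, h1, h2, h3⟩ := extremePoints_convexHull_subset hp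
  refine ⟨X, y, Prod.ext hX hy, ?_, ?_, ?_⟩
  · rw [hX] at h1; exact_mod_cast h1
  · rw [hy] at h2; exact_mod_cast h2
  · rw [hX, hy] at h3; exact_mod_cast h3

theorem vert_ext (a b c : ℕ) (p : ℝ × ℝ) (hp : p ∈ twoKnapVert a b c)
    (q1 q2 : ℝ × ℝ) (h1 : q1 ∈ convexHull ℝ (knapS a b c)) (h2 : q2 ∈ convexHull ℝ (knapS a b c))
    (α β : ℝ) (hα : 0 < α) (hβ : 0 < β) (hs : α + β = 1) (he : α • q1 + β • q2 = p) : q1 = p := by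
  have := (mem_extremePoints.mp hp).2 q1 h1 q2 h2 ⟨α, β, hα, hβ, hs, he⟩
  exact this.1

theorem vert_mid (a b c : ℕ) (X y : ℤ) (hp : (((X:ℝ), (y:ℝ)) : ℝ × ℝ) ∈ twoKnapVert a b c)
    (k j : ℤ) (h1 : 0 ≤ X+k) (h2 : 0 ≤ y+j) (h3 : a*(X+k)+b*(y+j) ≤ c)
    (h1' : 0 ≤ X-k) (h2' : 0 ≤ y-j) (h3' : a*(X-k)+b*(y-j) ≤ c) : k = 0 ∧ j = 0 := by
  have := vert_ext a b c _ hp _ _ (subset_convexHull ℝ _ (mem_knapS a b c _ _ h1 h2 h3))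
    (subset_convexHull ℝ _ (mem_knapS a b c _ _ h1' h2' h3')) (1/2) (1/2) (by norm_num)
    (by norm_num) (by norm_num) (by ext <;> simp <;> ring)
  simp at this
  exact this

theorem vert_x0 (a b c : ℕ) (y : ℤ) (hp : (((0:ℤ):ℝ), (y:ℝ)) ∈ twoKnapVert a b c)
    (h2 : 0 ≤ y) (h3 : b*y ≤ c) : y = 0 ∨ y = (c:ℤ)/b := by
  by_contra hcon
  push Not at hcon
  obtain ⟨hy0, hyb⟩ := hcon
  have hy : 1 ≤ y := by omega
  have hb0 : (0:ℤ) ≤ b := by positivity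
  have : ¬ (b*(y+1) ≤ (c:ℤ)) := by
    intro h
    have := vert_mid a b c 0 y hp 0 1 (by omega) (by omega) (by simpa using h) (by omega) (by omega)
      (by simp; linarith)
    omega
  apply hyb
  rcases hb0.eq_or_lt with h | h
  · rw [← h] at this; simp at this
  · symm
    rw [Int.ediv_eq_iff_of_pos h]
    constructor <;> linarith

theorem vert_xpos (a b c : ℕ) (X y : ℤ) (hp : ((X:ℝ), (y:ℝ)) ∈ twoKnapVert a b c)
    (h1 : 0 < X) (h2 : 0 ≤ y) (h3 : a*X+b*y ≤ c) : 0 < a ∧ X = ((c:ℤ)-b*y)/a := by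
  have ha0 : (0:ℤ) ≤ a := by positivity
  have : ¬ (a*(X+1)+b*y ≤ (c:ℤ)) := by
    intro h
    have := vert_mid a b c X y hp 1 0 (by omega) (by omega) (by simpa using h) (by omega) (by omega)
      (by simp; linarith)
    omega
  rcases ha0.eq_or_lt with h | h
  · rw [← h] at this h3; simp at this h3; omega
  · refine ⟨by exact_mod_cast h, ?_⟩
    symm
    rw [Int.ediv_eq_iff_of_pos h]
    constructor <;> linarith

theorem vert_KVC (a b c : ℕ) (ha : 0 < a) (hb : 0 < b) (X y : ℤ)
    (hp : ((X:ℝ), (y:ℝ)) ∈ twoKnapVert a b c)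
    (h1 : 0 < X) (h2 : 0 ≤ y) (h3 : a*X+b*y ≤ c) : KVC a b c ((c:ℤ)/b) y X := by
  have ha' : (0:ℤ) < a := by exact_mod_cast ha
  have hb' : (0:ℤ) < b := by exact_mod_cast hb
  have hYb : ∀ z : ℤ, z ≤ (c:ℤ)/b → b*z ≤ c := by
    intro z hz
    rw [Int.le_ediv_iff_mul_le hb'] at hz; linarith
  refine ⟨h2, ?_, h3, ?_⟩
  · rw [Int.le_ediv_iff_mul_le hb']; nlinarith
  · intro y1 X1 y2 X2 g1 g2 g3 g4 f1 f2
    by_contra hcon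
    push Not at hcon
    have key : ∀ z Z : ℤ, z ≤ (c:ℤ)/b → a*Z+b*z ≤ c →
        ∃ F : ℤ, Z ≤ F ∧ 0 ≤ F ∧ a*F+b*z ≤ c := by
      intro z Z hz hZ
      refine ⟨max Z 0, le_max_left _ _, le_max_right _ _, ?_⟩
      rcases le_total Z 0 with h | h
      · rw [max_eq_right h]; simpa using hYb z hz
      · rw [max_eq_left h]; exact hZ
    obtain ⟨F1, k1, k2, k3⟩ := key y1 X1 (by linarith) f1
    obtain ⟨F2, m1, m2, m3⟩ := key y2 X2 g4 f2
    have hF : X*(y2-y1) ≤ F1*(y2-y)+F2*(y-y1) := by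
      have := mul_le_mul_of_nonneg_right k1 (by linarith : 0 ≤ y2 - y)
      have := mul_le_mul_of_nonneg_right m1 (by linarith : 0 ≤ y - y1)
      linarith
    have hFR : (X:ℝ)*(y2-y1) ≤ F1*(y2-y)+F2*(y-y1) := by exact_mod_cast hF
    have hD : (0:ℝ) < y2 - y1 := by
      have : (0:ℤ) < y2 - y1 := by linarith
      exact_mod_cast this
    have hα : (0:ℝ) < (y2-y)/(y2-y1) := by
      apply div_pos _ hD
      have : (0:ℤ) < y2 - y := by linarith
      exact_mod_cast this
    have hβ : (0:ℝ) < (y-y1)/(y2-y1) := by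
      apply div_pos _ hD
      have : (0:ℤ) < y - y1 := by linarith
      exact_mod_cast this
    have hsum : ((y2:ℝ)-y)/(y2-y1) + (y-y1)/(y2-y1) = 1 := by
      field_simp; ring
    have hm1 := subset_convexHull ℝ _ (mem_knapS a b c F1 y1 k2 g1 k3)
    have hm2 := subset_convexHull ℝ _ (mem_knapS a b c F2 y2 m2 (by linarith) m3)
    obtain ⟨s, hs⟩ : ∃ s : ℝ, s = ((y2:ℝ)-y)/(y2-y1) * F1 + (y-y1)/(y2-y1) * F2 := ⟨_, rfl⟩
    have hcomb : (((y2:ℝ)-y)/(y2-y1)) • (((F1:ℝ), (y1:ℝ)) : ℝ × ℝ)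
        + (((y:ℝ)-y1)/(y2-y1)) • (((F2:ℝ), (y2:ℝ)) : ℝ × ℝ) = (s, (y:ℝ)) := by
      rw [hs]
      ext
      · simp
      · simp; field_simp; ring
    have hsX : (X:ℝ) ≤ s := by
      have : s = (F1*(y2-y)+F2*(y-y1))/((y2:ℝ)-y1) := by rw [hs]; field_simp
      rw [this, le_div_iff₀ hD]
      exact hFR
    have hsm : ((s, (y:ℝ)) : ℝ × ℝ) ∈ convexHull ℝ (knapS a b c) := by
      rw [← hcomb]
      exact convex_convexHull ℝ _ hm1 hm2 hα.le hβ.le hsum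
    rcases hsX.eq_or_lt with h | h
    · rw [← h] at hcomb
      have := vert_ext a b c _ hp _ _ hm1 hm2 _ _ hα hβ hsum hcomb
      simp at this
      omega
    · have h0m := subset_convexHull ℝ _ (mem_knapS a b c 0 y le_rfl h2 (by nlinarith))
      have hX0 : (0:ℝ) < X := by exact_mod_cast h1
      have hs0 : 0 < s := by linarith
      have := vert_ext a b c _ hp _ _ hsm h0m (X/s) (1-X/s) (by positivity)
        (by rw [sub_pos, div_lt_one hs0]; exact h) (by ring)
        (by
          ext
          · simp; field_simp
          · simp; ring)
      simp at this
      linarith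

theorem KVC_lr (a b c Y y X : ℤ) (ha : 0 < a) (h : KVC a b c Y y X) :
    KLeft a b c Y y ∨ KLeft a (-b) (c-b*Y) Y (Y-y) := by
  by_cases hr : KRec a b c y X
  · exact Or.inl ⟨X, h, hr⟩
  · right
    obtain ⟨h1, h2, h3, h4⟩ := h
    refine ⟨X, ⟨by linarith, by linarith, by linarith, ?_⟩, ?_⟩
    · intro y1 X1 y2 X2 g1 g2 g3 g4 f1 f2
      have := h4 (Y-y2) X2 (Y-y1) X1 (by linarith) (by linarith) (by linarith) (by linarith)
        (by linarith) (by linarith)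
      linarith
    · intro y' X' g1 g2 f
      unfold KRec at hr
      push Not at hr
      obtain ⟨z, Z, k1, k2, k3, k4⟩ := hr
      by_contra hcon
      push Not at hcon
      have h5 := h4 z Z (Y-y') X' k1 k2 (by linarith) (by linarith) k3 (by linarith)
      have h6 := mul_lt_mul_of_pos_left h5 ha
      have h7 := mul_le_mul_of_nonneg_right k4 (by linarith : 0 ≤ Y - y' - y)
      have h8 : (a*X+b*y)*(y-z) ≤ (a*X'+b*(Y-y'))*(y-z) := by
        apply mul_le_mul_of_nonneg_right _ (by linarith)
        linarith
      nlinarith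

/-- If `a < β_{s−1}`, then `|𝒩(a,b,c)| < 2s`. -/
theorem card_twoKnapVert_lt (s a b c : ℕ) (h : a < beta (s - 1)) :
    (twoKnapVert a b c).Finite ∧ (twoKnapVert a b c).ncard < 2 * s := by
  classical
  have hs : 2 ≤ s := by
    by_contra hcon
    have : s - 1 = 0 := by omega
    rw [this] at h; simp [beta] at h
  by_cases hab : 0 < a ∧ 0 < b
  · obtain ⟨ha, hb⟩ := hab
    have ha' : (0:ℤ) < a := by exact_mod_cast ha
    let Y : ℤ := (c:ℤ)/b
    let L := (Finset.Icc 0 Y).filter (fun y => KLeft a b c Y y)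
    let R := (Finset.Icc 0 Y).filter (fun y => KLeft a (-b) (c-b*Y) Y (Y-y))
    have hL : L.card < s - 1 := by
      by_contra hcon
      have := knap_left a b c Y ha' L (fun y hy => (Finset.mem_filter.mp hy).2) (s-1) (by omega)
      have : beta (s-1) ≤ a := by exact_mod_cast this
      omega
    have hR : R.card < s - 1 := by
      by_contra hcon
      have hc : (R.image (fun y => Y - y)).card = R.card :=
        Finset.card_image_of_injective _ (fun u v huv => by simpa using huv)
      have := knap_left a (-b) (c-b*Y) Y ha' (R.image (fun y => Y - y)) (by
        intro y hy
        obtain ⟨z, hz, rfl⟩ := Finset.mem_image.mp hy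
        exact (Finset.mem_filter.mp hz).2) (s-1) (by omega)
      have : beta (s-1) ≤ a := by exact_mod_cast this
      omega
    let φ : ℤ → ℝ × ℝ := fun y => (((((c:ℤ)-b*y)/a : ℤ) : ℝ), (y:ℝ))
    let T : Finset (ℝ × ℝ) := insert (((0:ℤ):ℝ), ((0:ℤ):ℝ)) (insert (((0:ℤ):ℝ), (Y:ℝ)) ((L ∪ R).image φ))
    have hsub : twoKnapVert a b c ⊆ (T : Set (ℝ × ℝ)) := by
      intro p hp
      obtain ⟨X, y, rfl, h1, h2, h3⟩ := vert_coords a b c p hp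
      simp only [T, Finset.coe_insert, Set.mem_insert_iff, Finset.mem_coe, Finset.mem_image]
      rcases h1.eq_or_lt with h0 | h0
      · subst h0
        rcases vert_x0 a b c y hp h2 (by simpa using h3) with h4 | h4
        · left; rw [h4]
        · right; left; rw [h4]
      · right; right
        have hK := vert_KVC a b c ha hb X y hp h0 h2 h3
        refine ⟨y, ?_, ?_⟩
        · have hI : y ∈ Finset.Icc 0 Y := Finset.mem_Icc.mpr ⟨hK.1, hK.2.1⟩
          rcases KVC_lr _ _ _ _ _ _ ha' hK with h5 | h5
          · exact Finset.mem_union_left _ (Finset.mem_filter.mpr ⟨hI, h5⟩)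
          · exact Finset.mem_union_right _ (Finset.mem_filter.mpr ⟨hI, h5⟩)
        · simp only [φ]
          rw [← (vert_xpos a b c X y hp h0 h2 h3).2]
    refine ⟨T.finite_toSet.subset hsub, ?_⟩
    have h1 := Set.ncard_le_ncard hsub T.finite_toSet
    rw [Set.ncard_coe_finset] at h1
    have h2 : T.card ≤ (L ∪ R).card + 1 + 1 := by
      refine (Finset.card_insert_le _ _).trans ?_
      gcongr
      refine (Finset.card_insert_le _ _).trans ?_
      gcongr
      exact Finset.card_image_le
    have h3 := Finset.card_union_le L R
    omega
  · let T : Finset (ℝ × ℝ) := {(((0:ℤ):ℝ), ((0:ℤ):ℝ)), (((0:ℤ):ℝ), (((c:ℤ)/b : ℤ):ℝ)),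
      (((((c:ℤ)-b*0)/a : ℤ):ℝ), ((0:ℤ):ℝ))}
    have hsub : twoKnapVert a b c ⊆ (T : Set (ℝ × ℝ)) := by
      intro p hp
      obtain ⟨X, y, rfl, h1, h2, h3⟩ := vert_coords a b c p hp
      simp only [T, Finset.coe_insert, Set.mem_insert_iff, Finset.coe_singleton,
        Set.mem_singleton_iff]
      rcases h1.eq_or_lt with h0 | h0
      · subst h0
        rcases vert_x0 a b c y hp h2 (by simpa using h3) with h4 | h4
        · left; rw [h4]
        · right; left; rw [h4]
      · right; right
        obtain ⟨ha, hX⟩ := vert_xpos a b c X y hp h0 h2 h3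
        have hb : b = 0 := by
          by_contra hb
          exact hab ⟨ha, Nat.pos_of_ne_zero hb⟩
        subst hb
        have hy : y = 0 := by
          by_contra hy
          have := vert_mid a 0 c X y hp 0 1 (by omega) (by omega) (by simpa using h3) (by omega)
            (by omega) (by simpa using h3)
          omega
        subst hy
        rw [← hX]
    refine ⟨T.finite_toSet.subset hsub, ?_⟩
    have h1 := Set.ncard_le_ncard hsub T.finite_toSet
    rw [Set.ncard_coe_finset] at h1
    have h2 : T.card ≤ 3 := Finset.card_le_three
    omega
end
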